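/- arXiv:1105.4952 — 2 statements merged into one kernel-verified Lean document; each statement's English description precedes it below -/
import Mathlib

section
/- Emptiness formation probability of the integrable spin-1 XXZ chain (explicit evaluation of the double integral): Let 0 < ζ < π/2, put η = iζ and ρ(x) = 1/(2ζ cosh(πx/ζ)). For ε > 0 define the complex numbers I₁₂(ε) = ∫_ℝ∫_ℝ [sinh(x₁+η/2) sinh(x₂−η/2) / (sinh η · sinh(x₂−x₁−iε))] ρ(x₁) ρ(x₂) dx₁ dx₂ and I₂₁(ε) = ∫_ℝ∫_ℝ [sinh(x₁−η/2) sinh(x₂+η/2) / (sinh η · sinh(x₂−x₁+2η+iε))] ρ(x₁) ρ(x₂) dx₁ dx₂. Then I₁₂(ε) − I₂₁(ε) tends, as ε → 0⁺, to (ζ − sin ζ cos ζ)/(2 ζ sin² ζ). -/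
open MeasureTheory Filter

/-- The density of string centers. -/
noncomputable def rho (ζ x : ℝ) : ℝ := 1 / (2 * ζ * Real.cosh (Real.pi * x / ζ))

/-- The square modulus of `sinh` on the complex plane. -/
theorem norm_sinh_sq (z : ℂ) :
    ‖Complex.sinh z‖ ^ 2 = Real.sinh z.re ^ 2 + Real.sin z.im ^ 2 := by
  rw [Complex.sq_norm, Complex.normSq_apply]
  have h : Complex.sinh z = (Real.sinh z.re * Real.cos z.im : ℝ)
      + (Real.cosh z.re * Real.sin z.im : ℝ) * Complex.I := by
    conv_lhs => rw [← Complex.re_add_im z]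
    rw [Complex.sinh_add, Complex.sinh_mul_I, Complex.cosh_mul_I]
    push_cast
    ring
  have hre : (Complex.sinh z).re = Real.sinh z.re * Real.cos z.im := by
    simp only [h, Complex.add_re, Complex.ofReal_re, Complex.re_ofReal_mul, Complex.I_re, mul_zero,
      add_zero]
  have him : (Complex.sinh z).im = Real.cosh z.re * Real.sin z.im := by
    simp only [h, Complex.add_im, Complex.ofReal_im, Complex.im_ofReal_mul, Complex.I_im, mul_one,
      zero_add]
  rw [hre, him]
  nlinarith [Real.cosh_sq z.re, Real.sin_sq_add_cos_sq z.im]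

theorem abs_sinh_re_le_norm_sinh (z : ℂ) : |Real.sinh z.re| ≤ ‖Complex.sinh z‖ := by
  refine abs_le_of_sq_le_sq ?_ (norm_nonneg _)
  rw [norm_sinh_sq]
  nlinarith [sq_nonneg (Real.sin z.im)]

theorem abs_sin_im_le_norm_sinh (z : ℂ) : |Real.sin z.im| ≤ ‖Complex.sinh z‖ := by
  refine abs_le_of_sq_le_sq ?_ (norm_nonneg _)
  rw [norm_sinh_sq]
  nlinarith [sq_nonneg (Real.sinh z.re)]

theorem norm_sinh_le_cosh_re (z : ℂ) : ‖Complex.sinh z‖ ≤ Real.cosh z.re := by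
  refine abs_le_of_sq_le_sq' ?_ (Real.cosh_pos _).le |>.2
  rw [norm_sinh_sq, Real.cosh_sq]
  nlinarith [Real.sin_sq_le_one z.im]

/-- `sinh` is bounded away from zero on closed horizontal strips inside `0 < Im z < π`. -/
theorem exists_pos_le_norm_sinh {a b : ℝ} (ha : 0 < a) (hb : b < Real.pi) :
    ∃ m > 0, ∀ z : ℂ, z.im ∈ Set.Icc a b → m ≤ ‖Complex.sinh z‖ := by
  rcases lt_or_ge b a with hab | hab
  · exact ⟨1, one_pos, fun z hz => absurd (hz.1.trans hz.2) (not_le.2 hab)⟩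
  obtain ⟨y, hy, hmin⟩ := isCompact_Icc.exists_isMinOn (Set.nonempty_Icc.2 hab)
    Real.continuous_sin.continuousOn
  refine ⟨Real.sin y, Real.sin_pos_of_pos_of_lt_pi (ha.trans_le hy.1) (hy.2.trans_lt hb),
    fun z hz => ?_⟩
  exact (hmin hz).trans ((le_abs_self _).trans (abs_sin_im_le_norm_sinh z))

/-- Moving the line of integration inside a horizontal strip of holomorphy. -/
theorem integral_eq_integral_of_strip {h : ℂ → ℂ} {a b C : ℝ} (hab : a ≤ b)
    (hd : DifferentiableOn ℂ h {z | z.im ∈ Set.Icc a b})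
    (hC : ∀ z : ℂ, z.im ∈ Set.Icc a b → ‖h z‖ ≤ C * (1 + z.re ^ 2)⁻¹) :
    ∫ x : ℝ, h (x + a * Complex.I) = ∫ x : ℝ, h (x + b * Complex.I) := by
  have hline : ∀ y ∈ Set.Icc a b, Integrable fun x : ℝ => h (x + y * Complex.I) := by
    intro y hy
    refine (integrable_inv_one_add_sq.const_mul C).mono' ?_ (.of_forall fun x => ?_)
    · refine (hd.continuousOn.comp_continuous (by fun_prop) fun x => ?_).aestronglyMeasurable
      simpa using hy
    · simpa using hC (x + y * Complex.I) (by simpa using hy)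
  have hlim := fun y hy => intervalIntegral_tendsto_integral (hline y hy)
    tendsto_neg_atTop_atBot tendsto_id
  have hdecay : Tendsto (fun R : ℝ => C * (1 + R ^ 2)⁻¹ * |b - a|) atTop (nhds 0) := by
    have : Tendsto (fun R : ℝ => (1 + R ^ 2)⁻¹) atTop (nhds 0) :=
      tendsto_inv_atTop_zero.comp (tendsto_atTop_add_const_left _ _
        (tendsto_pow_atTop (by norm_num)))
    simpa using (this.const_mul C).mul_const |b - a|
  have hside : ∀ s : ℝ, s ^ 2 = 1 → Tendsto (fun R : ℝ =>
      ∫ y in a..b, h ((s * R : ℝ) + y * Complex.I)) atTop (nhds 0) := by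
    intro s hs
    refine squeeze_zero_norm (fun R => ?_) hdecay
    refine intervalIntegral.norm_integral_le_of_norm_le_const fun y hy => ?_
    rw [Set.uIoc_of_le hab] at hy
    have := hC ((s * R : ℝ) + y * Complex.I) (by simpa using Set.Ioc_subset_Icc_self hy)
    simpa [mul_pow, hs] using this
  have hrect : ∀ R : ℝ, (∫ x in (-R)..R, h (x + a * Complex.I))
      - (∫ x in (-R)..R, h (x + b * Complex.I))
      + Complex.I • (∫ y in a..b, h ((1 * R : ℝ) + y * Complex.I))
      - Complex.I • (∫ y in a..b, h ((-1 * R : ℝ) + y * Complex.I)) = 0 := by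
    intro R
    have := Complex.integral_boundary_rect_eq_zero_of_differentiableOn h
      ⟨-R, a⟩ ⟨R, b⟩ (hd.mono fun z hz => by
        have := hz.2
        rwa [Set.uIcc_of_le hab] at this)
    simpa using this
  have hL := (((hlim a ⟨le_rfl, hab⟩).sub (hlim b ⟨hab, le_rfl⟩)).add
    ((hside 1 (by norm_num)).const_smul Complex.I)).sub
    ((hside (-1) (by norm_num)).const_smul Complex.I)
  have := tendsto_nhds_unique hL (tendsto_const_nhds.congr fun R => (hrect R).symm)
  simp only [smul_zero, add_zero, sub_zero] at this
  exact sub_eq_zero.1 this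

/-- The logistic form of the Beta integral `B(1 + b, 1 - b)`. -/
theorem integrable_and_integral_sigmoid_mul_exp {b : ℝ} (hb : |b| < 1) :
    Integrable (fun y : ℝ =>
      ((Real.sigmoid y * (1 - Real.sigmoid y) * Real.exp (b * y) : ℝ) : ℂ)) ∧
    ∫ y : ℝ, ((Real.sigmoid y * (1 - Real.sigmoid y) * Real.exp (b * y) : ℝ) : ℂ)
      = Complex.Gamma (1 + b) * Complex.Gamma (1 - b) := by
  obtain ⟨hb1, hb2⟩ := abs_lt.1 hb
  have hu : 0 < (1 + b : ℂ).re := by simp; linarith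
  have hv : 0 < (1 - b : ℂ).re := by simp; linarith
  set g : ℝ → ℂ := fun x => (x : ℂ) ^ ((1 + b : ℂ) - 1) * (1 - (x : ℂ)) ^ ((1 - b : ℂ) - 1)
  have hpt : ∀ y : ℝ, |Real.sigmoid y * (1 - Real.sigmoid y)| • g (Real.sigmoid y)
      = ((Real.sigmoid y * (1 - Real.sigmoid y) * Real.exp (b * y) : ℝ) : ℂ) := by
    intro y
    have h0 := Real.sigmoid_pos y
    have h1 : 0 < 1 - Real.sigmoid y := sub_pos.2 (Real.sigmoid_lt_one y)
    have hg : g (Real.sigmoid y) = ((Real.exp (b * y) : ℝ) : ℂ) := by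
      have hs : Real.sigmoid y = (1 - Real.sigmoid y) * Real.exp y := by
        rw [← Real.sigmoid_neg, ← Real.sigmoid_mul_rexp_neg, mul_assoc, ← Real.exp_add]
        simp
      have e1 : ((1 : ℂ) + b) - 1 = (b : ℝ) := by ring
      have e2 : ((1 : ℂ) - b) - 1 = ((-b : ℝ) : ℂ) := by push_cast; ring
      simp only [g]
      rw [e1, e2, ← Complex.ofReal_one, ← Complex.ofReal_sub, ← Complex.ofReal_cpow h0.le,
        ← Complex.ofReal_cpow h1.le, ← Complex.ofReal_mul]
      congr 1
      nth_rw 1 [hs]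
      rw [Real.mul_rpow h1.le (Real.exp_pos y).le, Real.rpow_neg h1.le, ← Real.exp_mul]
      have := (Real.rpow_pos_of_pos h1 b).ne'
      field_simp
    rw [hg, abs_of_pos (mul_pos h0 h1), Complex.real_smul]
    push_cast
    ring
  have hder : ∀ y ∈ Set.univ, HasDerivWithinAt Real.sigmoid
      (Real.sigmoid y * (1 - Real.sigmoid y)) Set.univ y :=
    fun y _ => (Real.hasDerivAt_sigmoid y).hasDerivWithinAt
  have hint := integrableOn_image_iff_integrableOn_abs_deriv_smul MeasurableSet.univ hder
    Real.sigmoid_injective.injOn g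
  have hval := integral_image_eq_integral_abs_deriv_smul MeasurableSet.univ hder
    Real.sigmoid_injective.injOn g
  simp only [hpt, Set.image_univ, Real.range_sigmoid, integrableOn_univ,
    Measure.restrict_univ] at hint hval
  refine ⟨hint.1 ?_, ?_⟩
  · have := Complex.betaIntegral_convergent hu hv
    rw [intervalIntegrable_iff_integrableOn_Ioo_of_le zero_le_one] at this
    exact this
  · rw [← hval, Complex.Gamma_mul_Gamma_eq_betaIntegral hu hv, Complex.betaIntegral,
      intervalIntegral.integral_of_le zero_le_one, integral_Ioc_eq_integral_Ioo]
    have : (1 + b + (1 - b) : ℂ) = 2 := by ring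
    rw [this, Complex.Gamma_ofNat_eq_factorial]
    simp [g]

/-- The entire function `sinh w / w`. -/
noncomputable def sinhQuot (w : ℂ) : ℂ := dslope Complex.sinh 0 w

theorem sinhQuot_zero : sinhQuot 0 = 1 := by
  simp [sinhQuot, dslope_same]

theorem sinhQuot_of_ne {w : ℂ} (hw : w ≠ 0) : sinhQuot w = Complex.sinh w / w := by
  rw [sinhQuot, dslope_of_ne _ hw, slope_def_field]
  simp

theorem sinhQuot_neg (w : ℂ) : sinhQuot (-w) = sinhQuot w := by
  rcases eq_or_ne w 0 with rfl | hw
  · simp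
  · rw [sinhQuot_of_ne hw, sinhQuot_of_ne (neg_ne_zero.2 hw), Complex.sinh_neg, neg_div_neg_eq]

theorem differentiable_sinhQuot : Differentiable ℂ sinhQuot :=
  differentiableOn_univ.1 ((Complex.differentiableOn_dslope univ_mem).2
    Complex.differentiable_sinh.differentiableOn)

theorem sinhQuot_ne_zero {w : ℂ} (hw : |w.im| < Real.pi) : sinhQuot w ≠ 0 := by
  rcases eq_or_ne w 0 with rfl | h0
  · simp [sinhQuot_zero]
  rw [sinhQuot_of_ne h0]
  refine div_ne_zero (fun h => h0 ?_) h0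
  have h1 := abs_sinh_re_le_norm_sinh w
  have h2 := abs_sin_im_le_norm_sinh w
  rw [h, norm_zero, abs_nonpos_iff] at h1 h2
  have him : w.im = 0 :=
    (Real.sin_eq_zero_iff_of_lt_of_lt (abs_lt.1 hw).1 (abs_lt.1 hw).2).1 h2
  exact Complex.ext (by simpa using h1) (by simpa using him)

/-- The function `(π / ζ) sinh w / sinh (π w / ζ)`, with its singularity at `0` removed. -/
noncomputable def sinhRatio (ζ : ℝ) (w : ℂ) : ℂ :=
  sinhQuot w / sinhQuot ((Real.pi / ζ : ℝ) * w)

theorem sinhRatio_neg (ζ : ℝ) (w : ℂ) : sinhRatio ζ (-w) = sinhRatio ζ w := by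
  rw [sinhRatio, mul_neg, sinhQuot_neg, sinhQuot_neg, sinhRatio]

theorem sinhRatio_of_ne {ζ : ℝ} (hζ : 0 < ζ) {w : ℂ} (hw : w ≠ 0) :
    sinhRatio ζ w =
      (Real.pi / ζ : ℝ) * (Complex.sinh w / Complex.sinh ((Real.pi / ζ : ℝ) * w)) := by
  have hc : ((Real.pi / ζ : ℝ) : ℂ) ≠ 0 := by
    exact_mod_cast (div_pos Real.pi_pos hζ).ne'
  rw [sinhRatio, sinhQuot_of_ne hw, sinhQuot_of_ne (mul_ne_zero hc hw)]
  field_simp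

theorem differentiableOn_sinhRatio {ζ : ℝ} (hζ : 0 < ζ) :
    DifferentiableOn ℂ (sinhRatio ζ) {z | z.im ∈ Set.Icc (-(ζ / 2)) (ζ / 2)} := by
  refine differentiable_sinhQuot.differentiableOn.fun_div
    (differentiable_sinhQuot.comp (differentiable_id.const_mul _)).differentiableOn
    fun z hz => sinhQuot_ne_zero ?_
  have hz' : |z.im| ≤ ζ / 2 := abs_le.2 hz
  change |((Real.pi / ζ : ℝ) * z : ℂ).im| < Real.pi
  rw [Complex.im_ofReal_mul, abs_mul, abs_of_pos (div_pos Real.pi_pos hζ)]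
  calc Real.pi / ζ * |z.im| ≤ Real.pi / ζ * (ζ / 2) := by gcongr
    _ = Real.pi / 2 := by field_simp
    _ < Real.pi := by linarith [Real.pi_pos]

theorem cosh_mul_one_add_sq_le {t c : ℝ} (ht : 1 ≤ |t|) (hc : 2 ≤ c) :
    Real.cosh t * (1 + t ^ 2) ≤ 4 * |Real.sinh (c * t)| := by
  rw [← Real.cosh_abs, ← sq_abs, Real.abs_sinh, abs_mul, abs_of_nonneg (by linarith : 0 ≤ c)]
  set s := |t|
  have h1 : Real.sinh (2 * s) ≤ Real.sinh (c * s) := Real.sinh_le_sinh.2 (by gcongr)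
  have h2 := Real.quadratic_le_exp_of_nonneg (by linarith : 0 ≤ s)
  have h3 : Real.exp (-s) ≤ 1 := Real.exp_le_one_iff.2 (by linarith)
  have h4 : 1 + s ^ 2 ≤ 8 * Real.sinh s := by
    rw [Real.sinh_eq]
    nlinarith
  rw [Real.sinh_two_mul] at h1
  nlinarith [Real.cosh_pos s]

theorem exists_norm_sinhRatio_le {ζ : ℝ} (hζ : 0 < ζ) (hζ' : ζ < Real.pi / 2) :
    ∃ C, ∀ z : ℂ, z.im ∈ Set.Icc (-(ζ / 2)) (ζ / 2) →
      ‖sinhRatio ζ z‖ ≤ C * (1 + z.re ^ 2)⁻¹ := by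
  obtain ⟨M, hM⟩ := (isCompact_Icc.reProdIm isCompact_Icc :
    IsCompact (Set.Icc (-1 : ℝ) 1 ×ℂ Set.Icc (-(ζ / 2)) (ζ / 2))).exists_bound_of_continuousOn
    ((differentiableOn_sinhRatio hζ).continuousOn.mono fun z hz => hz.2)
  refine ⟨max (2 * M) (Real.pi / ζ * 4), fun z hz => ?_⟩
  have hpos : 0 < 1 + z.re ^ 2 := by positivity
  rw [← div_eq_mul_inv, le_div_iff₀ hpos]
  rcases le_total |z.re| 1 with h | h
  · refine le_trans ?_ (le_max_left _ _)
    have h1 := hM z ⟨abs_le.1 h, hz⟩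
    have h2 : z.re ^ 2 ≤ 1 := (sq_le_one_iff_abs_le_one _).2 h
    nlinarith [norm_nonneg (sinhRatio ζ z)]
  · refine le_trans ?_ (le_max_right _ _)
    have hz0 : z ≠ 0 := by
      rintro rfl
      norm_num at h
    have hc : 0 < Real.pi / ζ := div_pos Real.pi_pos hζ
    have hc2 : 2 ≤ Real.pi / ζ := by
      rw [le_div_iff₀ hζ]
      linarith
    have hb := cosh_mul_one_add_sq_le h hc2
    have hs := abs_sinh_re_le_norm_sinh ((Real.pi / ζ : ℝ) * z)
    rw [Complex.re_ofReal_mul] at hs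
    have hs0 : 0 < ‖Complex.sinh ((Real.pi / ζ : ℝ) * z)‖ := by
      have := mul_pos (Real.cosh_pos z.re) hpos
      linarith
    rw [sinhRatio_of_ne hζ hz0, norm_mul, norm_div, Complex.norm_real, Real.norm_eq_abs,
      abs_of_pos hc, mul_assoc]
    gcongr
    rw [div_mul_eq_mul_div, div_le_iff₀ hs0]
    nlinarith [norm_sinh_le_cosh_re z]

/-- The boundary values of `sinhRatio`. -/
theorem sinh_add_mul_rho {ζ : ℝ} (hζ : 0 < ζ) (x : ℝ) :
    Complex.sinh (x + (ζ / 2 : ℝ) * Complex.I) * (rho ζ x : ℂ) =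
      Complex.I / (2 * Real.pi) * sinhRatio ζ (x + (ζ / 2 : ℝ) * Complex.I) := by
  have h0 : (x + (ζ / 2 : ℝ) * Complex.I : ℂ) ≠ 0 := by
    intro h
    have := congrArg Complex.im h
    simp at this
    exact hζ.ne' this
  have hcosh : Complex.cosh ((Real.pi * x / ζ : ℝ) : ℂ) ≠ 0 := by
    exact_mod_cast (Real.cosh_pos _).ne'
  have hζc : (ζ : ℂ) ≠ 0 := by exact_mod_cast hζ.ne'
  have hπ : (Real.pi : ℂ) ≠ 0 := by exact_mod_cast Real.pi_ne_zero
  have harg : ((Real.pi / ζ : ℝ) * (x + (ζ / 2 : ℝ) * Complex.I) : ℂ)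
      = ((Real.pi * x / ζ : ℝ) : ℂ) + (Real.pi / 2 : ℂ) * Complex.I := by
    push_cast
    field_simp
  have hden : Complex.sinh (((Real.pi * x / ζ : ℝ) : ℂ) + (Real.pi / 2 : ℂ) * Complex.I)
      = Complex.cosh ((Real.pi * x / ζ : ℝ) : ℂ) * Complex.I := by
    rw [Complex.sinh_add, Complex.sinh_mul_I, Complex.cosh_mul_I, Complex.cos_pi_div_two,
      Complex.sin_pi_div_two]
    ring
  rw [sinhRatio_of_ne hζ h0, harg, hden, rho]
  push_cast at hcosh ⊢
  have := Complex.I_ne_zero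
  field_simp

theorem sinh_sub_mul_rho {ζ : ℝ} (hζ : 0 < ζ) (x : ℝ) :
    Complex.sinh (x - (ζ / 2 : ℝ) * Complex.I) * (rho ζ x : ℂ) =
      -(Complex.I / (2 * Real.pi)) * sinhRatio ζ (x - (ζ / 2 : ℝ) * Complex.I) := by
  have h := sinh_add_mul_rho hζ (-x)
  have e : (((-x : ℝ) : ℂ) + (ζ / 2 : ℝ) * Complex.I) = -(x - (ζ / 2 : ℝ) * Complex.I) := by
    push_cast
    ring
  have hr : rho ζ (-x) = rho ζ x := by
    simp [rho, neg_div, Real.cosh_neg]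
  rw [e, Complex.sinh_neg, sinhRatio_neg, hr] at h
  linear_combination -h

theorem sinh_add_mul_I_ne_zero {c : ℝ} (hc : Real.sin c ≠ 0) (u : ℂ) (hu : u.im = 0) :
    Complex.sinh (u + c * Complex.I) ≠ 0 := by
  intro h
  have := abs_sin_im_le_norm_sinh (u + c * Complex.I)
  rw [h, norm_zero, abs_nonpos_iff] at this
  exact hc (by simpa [hu] using this)

theorem continuous_inv_sinh {c : ℝ} (hc : Real.sin c ≠ 0) :
    Continuous fun p : ℝ × ℝ => 1 / Complex.sinh ((p.2 : ℂ) - p.1 + c * Complex.I) :=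
  continuous_const.div (Complex.continuous_sinh.comp (by fun_prop))
    fun p => sinh_add_mul_I_ne_zero hc _ (by simp)

theorem norm_inv_sinh_le {c : ℝ} (hc : Real.sin c ≠ 0) (u : ℂ) (hu : u.im = 0) :
    ‖1 / Complex.sinh (u + c * Complex.I)‖ ≤ |Real.sin c|⁻¹ := by
  rw [norm_div, norm_one, one_div]
  gcongr
  simpa [hu] using abs_sin_im_le_norm_sinh (u + c * Complex.I)

theorem integrable_mul_prod_inv_sinh {P Q : ℝ → ℂ} (hP : Integrable P) (hQ : Integrable Q)
    {c : ℝ} (hc : Real.sin c ≠ 0) :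
    Integrable (fun p : ℝ × ℝ =>
      P p.1 * Q p.2 * (1 / Complex.sinh ((p.2 : ℂ) - p.1 + c * Complex.I)))
      (volume.prod volume) :=
  (hP.mul_prod hQ).mul_bdd (c := |Real.sin c|⁻¹)
    (continuous_inv_sinh hc).aestronglyMeasurable
    (.of_forall fun p => norm_inv_sinh_le hc _ (by simp))

theorem integral_integral_sinh_swap {P Q : ℝ → ℂ} (hP : Integrable P) (hQ : Integrable Q)
    {c : ℝ} (hc : Real.sin c ≠ 0) :
    ∫ x : ℝ, ∫ y : ℝ, P x * Q y * (1 / Complex.sinh ((y : ℂ) - x + c * Complex.I)) =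
      ∫ y : ℝ, ∫ x : ℝ, P x * Q y * (1 / Complex.sinh ((y : ℂ) - x + c * Complex.I)) :=
  integral_integral_swap (integrable_mul_prod_inv_sinh hP hQ hc)

theorem integrable_mul_integral_inv_sinh {P Q : ℝ → ℂ} (hP : Integrable P) (hQ : Integrable Q)
    {c : ℝ} (hc : Real.sin c ≠ 0) :
    Integrable fun y : ℝ =>
      Q y * ∫ x : ℝ, P x * (1 / Complex.sinh ((y : ℂ) - x + c * Complex.I)) := by
  have h := (integrable_mul_prod_inv_sinh hP hQ hc).integral_prod_right
  refine h.congr (.of_forall fun y => ?_)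
  simp only
  rw [← integral_const_mul]
  congr 1
  ext x
  ring

theorem integrable_mul_inv_sinh {P : ℝ → ℂ} (hP : Integrable P) {c : ℝ} (hc : Real.sin c ≠ 0)
    (y : ℝ) :
    Integrable fun x : ℝ => P x * (1 / Complex.sinh ((y : ℂ) - x + c * Complex.I)) :=
  hP.mul_bdd (c := |Real.sin c|⁻¹)
    ((continuous_inv_sinh hc).comp (continuous_id.prodMk continuous_const)).aestronglyMeasurable
    (.of_forall fun x => norm_inv_sinh_le hc _ (by simp))

theorem inv_sinh_sub_inv_sinh {ε : ℝ} (hε : Real.sin ε ≠ 0) (u : ℝ) :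
    1 / Complex.sinh ((u : ℂ) + (-ε : ℝ) * Complex.I)
      - 1 / Complex.sinh ((u : ℂ) + ε * Complex.I)
      = 2 * Complex.I *
        ((Real.cosh u / Real.sin ε * (1 + (Real.sinh u / Real.sin ε) ^ 2)⁻¹ : ℝ) : ℂ) := by
  have h1 := sinh_add_mul_I_ne_zero hε u (by simp)
  have h2 := sinh_add_mul_I_ne_zero (c := -ε) (by simpa using hε) u (by simp)
  have hs : (Real.sin ε : ℂ) ≠ 0 := by exact_mod_cast hε
  have hd : ((1 + (Real.sinh u / Real.sin ε) ^ 2 : ℝ) : ℂ) ≠ 0 := by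
    exact_mod_cast (by positivity : (0 : ℝ) < 1 + (Real.sinh u / Real.sin ε) ^ 2).ne'
  rw [Complex.ofReal_mul, Complex.ofReal_inv, div_sub_div _ _ h2 h1, ← mul_assoc,
    ← div_eq_mul_inv, div_eq_div_iff (mul_ne_zero h2 h1) hd]
  rw [Complex.sinh_add, Complex.sinh_add, Complex.sinh_mul_I, Complex.cosh_mul_I,
    Complex.sinh_mul_I, Complex.cosh_mul_I]
  push_cast at hs ⊢
  rw [Complex.cos_neg, Complex.sin_neg]
  field_simp
  have e1 := Complex.cosh_sq (u : ℂ)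
  have e2 := Complex.sin_sq_add_cos_sq (ε : ℂ)
  have e3 := Complex.I_sq
  generalize Complex.cosh u = a at *
  generalize Complex.sinh u = b at *
  generalize Complex.sin ε = s at *
  generalize Complex.cos ε = d at *
  linear_combination 2 * a * s * Complex.I * (a ^ 2 * s ^ 2 * e3 - s ^ 2 * e1 - b ^ 2 * e2)

theorem integral_mul_inv_sinh_sub {ε : ℝ} (hε : 0 < Real.sin ε) (P : ℝ → ℂ) (x : ℝ) :
    ∫ y : ℝ, P y * (1 / Complex.sinh ((x : ℂ) - y + (-ε : ℝ) * Complex.I)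
      - 1 / Complex.sinh ((x : ℂ) - y + ε * Complex.I))
      = 2 * Complex.I *
        ∫ t : ℝ, P (x - Real.arsinh (Real.sin ε * t)) * (((1 + t ^ 2)⁻¹ : ℝ) : ℂ) := by
  have hder : ∀ u ∈ Set.univ, HasDerivWithinAt (fun u => Real.sinh u / Real.sin ε)
      (Real.cosh u / Real.sin ε) Set.univ u :=
    fun u _ => ((Real.hasDerivAt_sinh u).div_const _).hasDerivWithinAt
  have hinj : Set.InjOn (fun u => Real.sinh u / Real.sin ε) Set.univ := by
    intro u _ v _ h
    exact Real.sinh_injective ((div_left_inj' hε.ne').1 h)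
  have hrange : (fun u => Real.sinh u / Real.sin ε) '' Set.univ = Set.univ := by
    rw [Set.image_univ, Set.range_eq_univ]
    intro t
    exact ⟨Real.arsinh (t * Real.sin ε), by simp [hε.ne']⟩
  have hsub := integral_image_eq_integral_abs_deriv_smul MeasurableSet.univ hder hinj
    fun t => P (x - Real.arsinh (Real.sin ε * t)) * (((1 + t ^ 2)⁻¹ : ℝ) : ℂ)
  rw [hrange] at hsub
  simp only [Measure.restrict_univ] at hsub
  rw [hsub, ← integral_sub_left_eq_self _ volume x, ← integral_const_mul]
  refine integral_congr_ae (.of_forall fun u => ?_)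
  have hu : (x : ℂ) - ((x - u : ℝ) : ℂ) = (u : ℂ) := by
    push_cast
    ring
  simp only
  rw [hu, inv_sinh_sub_inv_sinh hε.ne', mul_div_cancel₀ _ hε.ne', Real.arsinh_sinh,
    abs_of_pos (div_pos (Real.cosh_pos u) hε), Complex.real_smul]
  push_cast
  ring

/-- The jump of `1 / sinh` across the real line acts as a multiple of the Dirac mass. -/
theorem tendsto_integral_mul_inv_sinh_sub {P Q : ℝ → ℂ} (hP : Continuous P) {M : ℝ}
    (hM : ∀ x, ‖P x‖ ≤ M) (hQ : Integrable Q) :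
    Tendsto (fun ε : ℝ => ∫ x : ℝ, Q x *
        ∫ y : ℝ, P y * (1 / Complex.sinh ((x : ℂ) - y + (-ε : ℝ) * Complex.I)
          - 1 / Complex.sinh ((x : ℂ) - y + ε * Complex.I)))
      (nhdsWithin 0 (Set.Ioi 0)) (nhds (2 * Real.pi * Complex.I * ∫ x : ℝ, Q x * P x)) := by
  have hbound : ∀ ε x t : ℝ,
      ‖P (x - Real.arsinh (Real.sin ε * t)) * (((1 + t ^ 2)⁻¹ : ℝ) : ℂ)‖
        ≤ M * (1 + t ^ 2)⁻¹ := by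
    intro ε x t
    have : 0 < (1 + t ^ 2)⁻¹ := by positivity
    rw [norm_mul, Complex.norm_real, Real.norm_of_nonneg this.le]
    gcongr
    exact hM _
  have hgint := integrable_inv_one_add_sq.const_mul M
  have hpair : Continuous fun p : (ℝ × ℝ) × ℝ =>
      P (p.1.2 - Real.arsinh (Real.sin p.1.1 * p.2)) * (((1 + p.2 ^ 2)⁻¹ : ℝ) : ℂ) := by
    have : Continuous fun p : (ℝ × ℝ) × ℝ => (1 + p.2 ^ 2)⁻¹ :=
      Continuous.inv₀ (by fun_prop) fun p => by positivity
    exact (hP.comp ((continuous_snd.comp continuous_fst).sub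
      (Continuous.arsinh (by fun_prop)))).mul (Complex.continuous_ofReal.comp this)
  have hcont : Continuous fun p : ℝ × ℝ =>
      ∫ t : ℝ, P (p.2 - Real.arsinh (Real.sin p.1 * t)) * (((1 + t ^ 2)⁻¹ : ℝ) : ℂ) :=
    continuous_of_dominated
      (fun p => (hpair.comp (continuous_const.prodMk continuous_id)).aestronglyMeasurable)
      (fun p => .of_forall fun t => hbound p.1 p.2 t) hgint
      (.of_forall fun t => hpair.comp (continuous_id.prodMk continuous_const))
  have hzero : ∀ x : ℝ,
      ∫ t : ℝ, P (x - Real.arsinh (Real.sin 0 * t)) * (((1 + t ^ 2)⁻¹ : ℝ) : ℂ)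
        = Real.pi * P x := by
    intro x
    simp only [Real.sin_zero, zero_mul, Real.arsinh_zero, sub_zero]
    rw [integral_const_mul, integral_complex_ofReal, integral_univ_inv_one_add_sq, mul_comm]
  have hlim : Tendsto (fun ε : ℝ => ∫ x : ℝ, Q x * (2 * Complex.I *
      ∫ t : ℝ, P (x - Real.arsinh (Real.sin ε * t)) * (((1 + t ^ 2)⁻¹ : ℝ) : ℂ)))
      (nhdsWithin 0 (Set.Ioi 0))
      (nhds (∫ x : ℝ, Q x * (2 * Complex.I * (Real.pi * P x)))) := by
    refine tendsto_integral_filter_of_dominated_convergence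
      (fun x => ‖Q x‖ * (2 * ∫ t : ℝ, M * (1 + t ^ 2)⁻¹)) (.of_forall fun ε => ?_)
      (.of_forall fun ε => .of_forall fun x => ?_) (hQ.norm.mul_const _)
      (.of_forall fun x => ?_)
    · exact hQ.aestronglyMeasurable.mul (continuous_const.mul
        (hcont.comp (continuous_const.prodMk continuous_id))).aestronglyMeasurable
    · have := norm_integral_le_of_norm_le hgint (.of_forall (hbound ε x))
      rw [norm_mul, norm_mul, norm_mul, Complex.norm_I, Complex.norm_ofNat, mul_one]
      gcongr
    · have h := (hcont.comp (continuous_id.prodMk (continuous_const (y := x)))).tendsto 0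
      simp only [Function.comp_def, id, hzero] at h
      exact ((h.mono_left nhdsWithin_le_nhds).const_mul _).const_mul _
  have hrw : (2 * Real.pi * Complex.I * ∫ x : ℝ, Q x * P x)
      = ∫ x : ℝ, Q x * (2 * Complex.I * (Real.pi * P x)) := by
    rw [← integral_const_mul]
    congr 1
    ext x
    ring
  rw [hrw]
  refine hlim.congr' ?_
  filter_upwards [Ioo_mem_nhdsGT Real.pi_pos] with ε hε
  simp only [integral_mul_inv_sinh_sub (Real.sin_pos_of_mem_Ioo hε)]

theorem Gamma_one_add_mul_Gamma_one_sub {ζ : ℝ} (hζ : ζ ≠ 0) :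
    Complex.Gamma (1 + (ζ / Real.pi : ℝ)) * Complex.Gamma (1 - (ζ / Real.pi : ℝ))
      = ((ζ / Real.sin ζ : ℝ) : ℂ) := by
  have hπ : (Real.pi : ℂ) ≠ 0 := by exact_mod_cast Real.pi_ne_zero
  have hb : ((ζ / Real.pi : ℝ) : ℂ) ≠ 0 := by
    exact_mod_cast div_ne_zero hζ Real.pi_ne_zero
  rw [add_comm, Complex.Gamma_add_one _ hb, mul_assoc, Complex.Gamma_mul_Gamma_one_sub]
  have : (Real.pi : ℂ) * ((ζ / Real.pi : ℝ) : ℂ) = ζ := by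
    push_cast
    field_simp
  rw [this]
  push_cast
  field_simp

theorem sigmoid_mul_one_sub_sigmoid (y : ℝ) :
    Real.sigmoid (2 * y) * (1 - Real.sigmoid (2 * y)) = (4 * Real.cosh y ^ 2)⁻¹ := by
  rw [← Real.sigmoid_neg, Real.sigmoid_def, Real.sigmoid_def, Real.cosh_eq, neg_neg,
    ← mul_inv]
  congr 1
  have h1 : Real.exp (2 * y) = Real.exp y ^ 2 := by
    rw [← Real.exp_nat_mul]
    norm_num
  have h2 : Real.exp (-(2 * y)) = Real.exp (-y) ^ 2 := by
    rw [← Real.exp_nat_mul]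
    congr 1
    push_cast
    ring
  have h3 : Real.exp y * Real.exp (-y) = 1 := by
    rw [← Real.exp_add]
    simp
  rw [h1, h2]
  linear_combination (Real.exp y * Real.exp (-y) - 1) * h3

theorem sinhRatio_mul_sinhRatio {ζ : ℝ} (hζ : 0 < ζ) (x : ℝ) :
    sinhRatio ζ (x - (ζ / 2 : ℝ) * Complex.I) * sinhRatio ζ (x + (ζ / 2 : ℝ) * Complex.I)
      = ((Real.pi ^ 2 / (2 * ζ ^ 2) * ((Real.cosh (2 * x) - Real.cos ζ)
          / Real.cosh (Real.pi * x / ζ) ^ 2) : ℝ) : ℂ) := by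
  have hπ : (Real.pi : ℂ) ≠ 0 := by exact_mod_cast Real.pi_ne_zero
  have hζc : (ζ : ℂ) ≠ 0 := by exact_mod_cast hζ.ne'
  have hcosh : Complex.cosh (Real.pi * x / ζ : ℂ) ≠ 0 := by
    exact_mod_cast (Real.cosh_pos (Real.pi * x / ζ)).ne'
  have h1 := sinh_add_mul_rho hζ x
  have h2 := sinh_sub_mul_rho hζ x
  have hs : Complex.sinh (x + (ζ / 2 : ℝ) * Complex.I) *
      Complex.sinh (x - (ζ / 2 : ℝ) * Complex.I) = (Complex.cosh (2 * x) - Complex.cos ζ) / 2 := by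
    have e : (ζ : ℂ) = 2 * (ζ / 2 : ℝ) := by
      push_cast
      ring
    conv_rhs => rw [e]
    rw [Complex.sinh_add, Complex.sinh_sub, Complex.sinh_mul_I, Complex.cosh_mul_I,
      Complex.cosh_two_mul, Complex.cos_two_mul]
    linear_combination (-Complex.cosh x ^ 2 * Complex.sin (ζ / 2 : ℝ) ^ 2) * Complex.I_sq
      + (Complex.cosh x ^ 2) * Complex.sin_sq_add_cos_sq ((ζ / 2 : ℝ) : ℂ)
      + (-1 / 2 - Complex.cos (ζ / 2 : ℝ) ^ 2 + 1) * Complex.cosh_sq (x : ℂ)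
  have h := congrArg₂ (· * ·) h1 h2
  have hr : (rho ζ x : ℂ) = 1 / (2 * ζ * Complex.cosh (Real.pi * x / ζ)) := by
    rw [rho]
    push_cast
    rfl
  have hI := Complex.I_sq
  rw [mul_mul_mul_comm, hs, hr] at h
  generalize sinhRatio ζ (x - (ζ / 2 : ℝ) * Complex.I) = q at *
  generalize sinhRatio ζ (x + (ζ / 2 : ℝ) * Complex.I) = p at *
  have h' : q * p = 4 * Real.pi ^ 2 * (Complex.I / (2 * Real.pi) * p *
      (-(Complex.I / (2 * Real.pi)) * q)) := by
    field_simp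
    linear_combination (4 * q * p) * hI
  rw [h', ← h]
  push_cast
  field_simp
  norm_num

theorem integral_sinhRatio_mul_sinhRatio {ζ : ℝ} (hζ : 0 < ζ) (hζ' : ζ < Real.pi / 2) :
    ∫ x : ℝ, sinhRatio ζ (x - (ζ / 2 : ℝ) * Complex.I)
        * sinhRatio ζ (x + (ζ / 2 : ℝ) * Complex.I)
      = ((Real.pi / ζ * (ζ / Real.sin ζ - Real.cos ζ) : ℝ) : ℂ) := by
  have hb : |ζ / Real.pi| < 1 := by
    rw [abs_of_pos (div_pos hζ Real.pi_pos), div_lt_one Real.pi_pos]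
    linarith [Real.pi_pos]
  obtain ⟨i1, v1⟩ := integrable_and_integral_sigmoid_mul_exp hb
  obtain ⟨i2, v2⟩ := integrable_and_integral_sigmoid_mul_exp (b := -ζ / Real.pi)
    (by rwa [neg_div, abs_neg])
  obtain ⟨i0, v0⟩ := integrable_and_integral_sigmoid_mul_exp (b := 0) (by norm_num)
  rw [Gamma_one_add_mul_Gamma_one_sub hζ.ne'] at v1
  rw [Gamma_one_add_mul_Gamma_one_sub (neg_ne_zero.2 hζ.ne')] at v2
  obtain ⟨w, hw⟩ : ∃ w : ℝ → ℝ → ℂ, w = fun b y =>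
    ((Real.sigmoid y * (1 - Real.sigmoid y) * Real.exp (b * y) : ℝ) : ℂ) := ⟨_, rfl⟩
  obtain ⟨W, hW⟩ : ∃ W : ℝ → ℂ, W = fun y => (1 / 2) * (w (ζ / Real.pi) y
    + w (-ζ / Real.pi) y) - Real.cos ζ * w 0 y := ⟨_, rfl⟩
  have hpt : ∀ x : ℝ, sinhRatio ζ (x - (ζ / 2 : ℝ) * Complex.I)
        * sinhRatio ζ (x + (ζ / 2 : ℝ) * Complex.I)
      = (2 * Real.pi ^ 2 / ζ ^ 2 : ℂ) * W (2 * Real.pi / ζ * x) := by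
    intro x
    have hs := sigmoid_mul_one_sub_sigmoid (Real.pi * x / ζ)
    have e0 : 2 * Real.pi / ζ * x = 2 * (Real.pi * x / ζ) := by ring
    have e1 : ζ / Real.pi * (2 * (Real.pi * x / ζ)) = 2 * x := by
      have := Real.pi_ne_zero
      field_simp
    have e2 : -ζ / Real.pi * (2 * (Real.pi * x / ζ)) = -(2 * x) := by
      rw [neg_div, neg_mul, e1]
    simp only [hW, hw]
    rw [sinhRatio_mul_sinhRatio hζ, e0, hs, e1, e2, zero_mul, Real.exp_zero, Real.cosh_eq (2 * x)]
    have hcosh : Complex.cosh (Real.pi * x / ζ : ℂ) ≠ 0 := by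
      exact_mod_cast (Real.cosh_pos (Real.pi * x / ζ)).ne'
    push_cast
    field_simp
    ring
  simp only [hpt]
  have hWint : ∫ y, W y = (1 / 2) * (((ζ / Real.sin ζ : ℝ) : ℂ)
      + ((-ζ / Real.sin (-ζ) : ℝ) : ℂ)) - Real.cos ζ * 1 := by
    have e1 : ∫ y, w (ζ / Real.pi) y = ((ζ / Real.sin ζ : ℝ) : ℂ) := by
      rw [← v1, hw]
    have e2 : ∫ y, w (-ζ / Real.pi) y = ((-ζ / Real.sin (-ζ) : ℝ) : ℂ) := by
      rw [← v2, hw]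
    have e0 : ∫ y, w 0 y = 1 := by
      simpa [hw] using v0
    have j1 : Integrable fun y => w (ζ / Real.pi) y := by
      rw [hw]
      exact i1
    have j2 : Integrable fun y => w (-ζ / Real.pi) y := by
      rw [hw]
      exact i2
    have j0 : Integrable fun y => w 0 y := by
      rw [hw]
      exact i0
    have j12 : Integrable fun y => w (ζ / Real.pi) y + w (-ζ / Real.pi) y := j1.add j2
    rw [hW, integral_sub (j12.const_mul _) (j0.const_mul _), integral_const_mul,
      integral_const_mul, integral_add j1 j2, e1, e2, e0]
  rw [integral_const_mul, Measure.integral_comp_mul_left W, hWint,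
    abs_of_pos (by positivity), Complex.real_smul]
  have hsin : (Complex.sin ζ) ≠ 0 := by
    exact_mod_cast (Real.sin_pos_of_pos_of_lt_pi hζ (by linarith)).ne'
  have hζc : (ζ : ℂ) ≠ 0 := by exact_mod_cast hζ.ne'
  have hπ : (Real.pi : ℂ) ≠ 0 := by exact_mod_cast Real.pi_ne_zero
  rw [Real.sin_neg]
  push_cast
  field_simp
  ring

/-- Moving the line of integration across the strip `|Im z| ≤ ζ / 2`. -/
theorem integral_sinhRatio_div_sinh {ζ : ℝ} (hζ : 0 < ζ) (hζ' : ζ < Real.pi / 2) {c : ℝ}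
    (hc : 0 < c) (hc' : c + ζ < Real.pi) (t : ℝ) :
    ∫ x : ℝ, sinhRatio ζ (x + (ζ / 2 : ℝ) * Complex.I)
        * (1 / Complex.sinh ((x : ℂ) - t + (c + ζ : ℝ) * Complex.I))
      = ∫ x : ℝ, sinhRatio ζ (x - (ζ / 2 : ℝ) * Complex.I)
        * (1 / Complex.sinh ((x : ℂ) - t + c * Complex.I)) := by
  obtain ⟨m, hm, hsinh⟩ := exists_pos_le_norm_sinh hc hc'
  obtain ⟨C, hC⟩ := exists_norm_sinhRatio_le hζ hζ'
  have him : ∀ z : ℂ, z.im ∈ Set.Icc (-(ζ / 2)) (ζ / 2) →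
      m ≤ ‖Complex.sinh (z - t + (c + ζ / 2 : ℝ) * Complex.I)‖ := by
    intro z hz
    refine hsinh _ ?_
    have h1 := hz.1
    have h2 := hz.2
    constructor <;> simp <;> linarith
  have key := integral_eq_integral_of_strip
    (h := fun z => sinhRatio ζ z * (1 / Complex.sinh (z - t + (c + ζ / 2 : ℝ) * Complex.I)))
    (a := -(ζ / 2)) (b := ζ / 2) (C := C * m⁻¹) (by linarith) ?_ ?_
  · convert key.symm using 3 with x x
    · congr 3
      push_cast
      ring
    · congr 1
      · congr 1
        push_cast
        ring
      · congr 2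
        push_cast
        ring
  · refine (differentiableOn_sinhRatio hζ).mul (DifferentiableOn.div (by fun_prop) ?_ ?_)
    · exact (Complex.differentiable_sinh.comp (by fun_prop)).differentiableOn
    · intro z hz h
      have := him z hz
      rw [h, norm_zero] at this
      linarith
  · intro z hz
    rw [norm_mul, norm_div, norm_one, one_div, mul_right_comm]
    exact mul_le_mul (hC z hz) (inv_anti₀ hm (him z hz)) (by positivity)
      ((norm_nonneg _).trans (hC z hz))

theorem integral_sinhRatio_div_sinh_reflect {ζ : ℝ} (hζ : 0 < ζ) (hζ' : ζ < Real.pi / 2) {c : ℝ}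
    (hc : 0 < c) (hc' : c + ζ < Real.pi) (t : ℝ) :
    ∫ x : ℝ, sinhRatio ζ (x - (ζ / 2 : ℝ) * Complex.I)
        * (1 / Complex.sinh ((t : ℂ) - x + (c + ζ : ℝ) * Complex.I))
      = ∫ x : ℝ, sinhRatio ζ (x + (ζ / 2 : ℝ) * Complex.I)
        * (1 / Complex.sinh ((t : ℂ) - x + c * Complex.I)) := by
  have h := integral_sinhRatio_div_sinh hζ hζ' hc hc' (-t)
  have e1 := integral_neg_eq_self (fun x : ℝ => sinhRatio ζ (x + (ζ / 2 : ℝ) * Complex.I)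
    * (1 / Complex.sinh ((x : ℂ) - (-t : ℝ) + (c + ζ : ℝ) * Complex.I))) volume
  have e2 := integral_neg_eq_self (fun x : ℝ => sinhRatio ζ (x - (ζ / 2 : ℝ) * Complex.I)
    * (1 / Complex.sinh ((x : ℂ) - (-t : ℝ) + c * Complex.I))) volume
  rw [← e1, ← e2] at h
  have harg : ∀ x d : ℝ, (t : ℂ) - x + d * Complex.I
      = ((-x : ℝ) : ℂ) - (-t : ℝ) + d * Complex.I := by
    intro x d
    push_cast
    ring
  refine Eq.trans (integral_congr_ae (.of_forall fun x => ?_))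
    (h.trans (integral_congr_ae (.of_forall fun x => ?_)))
  · have hx : ((-x : ℝ) : ℂ) + (ζ / 2 : ℝ) * Complex.I = -(x - (ζ / 2 : ℝ) * Complex.I) := by
      push_cast
      ring
    beta_reduce
    rw [hx, sinhRatio_neg, harg]
  · have hx : ((-x : ℝ) : ℂ) - (ζ / 2 : ℝ) * Complex.I = -(x + (ζ / 2 : ℝ) * Complex.I) := by
      push_cast
      ring
    beta_reduce
    rw [hx, sinhRatio_neg, harg]

theorem continuous_sinhRatio_line {ζ : ℝ} (hζ : 0 < ζ) {y : ℝ}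
    (hy : y ∈ Set.Icc (-(ζ / 2)) (ζ / 2)) :
    Continuous fun x : ℝ => sinhRatio ζ (x + y * Complex.I) :=
  (differentiableOn_sinhRatio hζ).continuousOn.comp_continuous (by fun_prop)
    fun x => by simpa using hy

theorem integrable_sinhRatio_line {ζ : ℝ} (hζ : 0 < ζ) (hζ' : ζ < Real.pi / 2) {y : ℝ}
    (hy : y ∈ Set.Icc (-(ζ / 2)) (ζ / 2)) :
    Integrable fun x : ℝ => sinhRatio ζ (x + y * Complex.I) := by
  obtain ⟨C, hC⟩ := exists_norm_sinhRatio_le hζ hζ'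
  refine (integrable_inv_one_add_sq.const_mul C).mono'
    (continuous_sinhRatio_line hζ hy).aestronglyMeasurable (.of_forall fun x => ?_)
  simpa using hC (x + y * Complex.I) (by simpa using hy)

theorem exists_norm_sinhRatio_line_le {ζ : ℝ} (hζ : 0 < ζ) (hζ' : ζ < Real.pi / 2) {y : ℝ}
    (hy : y ∈ Set.Icc (-(ζ / 2)) (ζ / 2)) :
    ∃ M, ∀ x : ℝ, ‖sinhRatio ζ (x + y * Complex.I)‖ ≤ M := by
  obtain ⟨C, hC⟩ := exists_norm_sinhRatio_le hζ hζ'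
  have hC0 : 0 ≤ C := by
    simpa using (norm_nonneg _).trans (hC 0 (by simp; linarith))
  refine ⟨C, fun x => (hC _ (by simpa using hy)).trans ?_⟩
  exact mul_le_of_le_one_right hC0 (inv_le_one_of_one_le₀ (by nlinarith [sq_nonneg (x : ℝ)]))

/-- Emptiness formation probability of the integrable spin-1 XXZ chain:
explicit evaluation of the double-integral representation. -/
theorem stmt0 (ζ : ℝ) (hζ0 : 0 < ζ) (hζ1 : ζ < Real.pi / 2)
    (η : ℂ) (hη : η = Complex.I * ζ)
    (I12 I21 : ℝ → ℂ)
    (hI12 : ∀ ε : ℝ, I12 ε =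
      ∫ x₁ : ℝ, ∫ x₂ : ℝ,
        Complex.sinh ((x₁ : ℂ) + η / 2) * Complex.sinh ((x₂ : ℂ) - η / 2) /
          (Complex.sinh η * Complex.sinh ((x₂ : ℂ) - (x₁ : ℂ) - Complex.I * (ε : ℂ))) *
          (rho ζ x₁ : ℂ) * (rho ζ x₂ : ℂ))
    (hI21 : ∀ ε : ℝ, I21 ε =
      ∫ x₁ : ℝ, ∫ x₂ : ℝ,
        Complex.sinh ((x₁ : ℂ) - η / 2) * Complex.sinh ((x₂ : ℂ) + η / 2) /
          (Complex.sinh η * Complex.sinh ((x₂ : ℂ) - (x₁ : ℂ) + 2 * η + Complex.I * (ε : ℂ))) *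
          (rho ζ x₁ : ℂ) * (rho ζ x₂ : ℂ)) :
    Tendsto (fun ε : ℝ => I12 ε - I21 ε) (nhdsWithin 0 (Set.Ioi 0))
      (nhds (((ζ - Real.sin ζ * Real.cos ζ) / (2 * ζ * Real.sin ζ ^ 2) : ℝ) : ℂ)) := by
  have hπ : (Real.pi : ℂ) ≠ 0 := by exact_mod_cast Real.pi_ne_zero
  have hζc : (ζ : ℂ) ≠ 0 := by exact_mod_cast hζ0.ne'
  have hsin : Complex.sin ζ ≠ 0 := by
    exact_mod_cast (Real.sin_pos_of_pos_of_lt_pi hζ0 (by linarith)).ne'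
  have hsinh : Complex.sinh η = Complex.sin ζ * Complex.I := by
    rw [hη, mul_comm, Complex.sinh_mul_I]
  have hadd : ∀ x : ℝ, (x : ℂ) + η / 2 = x + (ζ / 2 : ℝ) * Complex.I := by
    intro x
    rw [hη]
    push_cast
    ring
  have hsub : ∀ x : ℝ, (x : ℂ) - η / 2 = x - (ζ / 2 : ℝ) * Complex.I := by
    intro x
    rw [hη]
    push_cast
    ring
  obtain ⟨P, hP⟩ : ∃ P : ℝ → ℂ, ∀ x : ℝ,
      sinhRatio ζ (x + (ζ / 2 : ℝ) * Complex.I) = P x := ⟨_, fun _ => rfl⟩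
  obtain ⟨Q, hQ⟩ : ∃ Q : ℝ → ℂ, ∀ x : ℝ,
      sinhRatio ζ (x - (ζ / 2 : ℝ) * Complex.I) = Q x := ⟨_, fun _ => rfl⟩
  have hmem : ζ / 2 ∈ Set.Icc (-(ζ / 2)) (ζ / 2) := ⟨by linarith, le_rfl⟩
  have hPc := continuous_sinhRatio_line hζ0 hmem
  have hPi := integrable_sinhRatio_line hζ0 hζ1 hmem
  obtain ⟨M, hM⟩ := exists_norm_sinhRatio_line_le hζ0 hζ1 hmem
  have hQi := integrable_sinhRatio_line hζ0 hζ1 (y := -(ζ / 2)) ⟨le_rfl, by linarith⟩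
  simp only [Complex.ofReal_neg, neg_mul, ← sub_eq_add_neg, hP, hQ] at hPc hPi hM hQi
  have hrhoP := sinh_add_mul_rho hζ0
  have hrhoQ := sinh_sub_mul_rho hζ0
  simp only [hP, hQ] at hrhoP hrhoQ
  simp only [← hadd, ← hsub] at hrhoP hrhoQ
  set K : ℂ := 1 / (4 * Real.pi ^ 2 * Complex.sinh η)
  have hprod : ∀ p q s r r' d : ℂ, ∀ s', s * r = Complex.I / (2 * Real.pi) * p →
      s' * r' = -(Complex.I / (2 * Real.pi)) * q →
      s * s' / (Complex.sinh η * d) * r * r' = K * (p * q * (1 / d)) := by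
    intro p q s r r' d s' h1 h2
    calc s * s' / (Complex.sinh η * d) * r * r'
        = (s * r) * (s' * r') / (Complex.sinh η * d) := by ring
      _ = -(Complex.I ^ 2) * (1 / (2 * Real.pi) ^ 2) * (p * q) / (Complex.sinh η * d) := by
        rw [h1, h2]
        ring
      _ = K * (p * q * (1 / d)) := by
        rw [Complex.I_sq]
        simp only [K, div_eq_mul_inv, mul_inv, mul_pow]
        ring_nf
  have h12 : ∀ ε : ℝ, Real.sin ε ≠ 0 → I12 ε = K * ∫ y : ℝ, Q y *
      ∫ x : ℝ, P x * (1 / Complex.sinh ((y : ℂ) - x + (-ε : ℝ) * Complex.I)) := by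
    intro ε hε
    have hpt : ∀ x₁ x₂ : ℝ, Complex.sinh ((x₁ : ℂ) + η / 2) * Complex.sinh ((x₂ : ℂ) - η / 2) /
          (Complex.sinh η * Complex.sinh ((x₂ : ℂ) - (x₁ : ℂ) - Complex.I * (ε : ℂ))) *
          (rho ζ x₁ : ℂ) * (rho ζ x₂ : ℂ)
        = K * (P x₁ * Q x₂ * (1 / Complex.sinh ((x₂ : ℂ) - x₁ + (-ε : ℝ) * Complex.I))) := by
      intro x₁ x₂
      rw [hprod _ _ _ _ _ _ _ (hrhoP x₁) (hrhoQ x₂)]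
      congr 4
      push_cast
      ring
    rw [hI12]
    simp only [hpt, integral_const_mul]
    rw [integral_integral_sinh_swap hPi hQi (by simpa using hε)]
    congr 2
    ext y
    rw [← integral_const_mul]
    congr 1
    ext x
    ring
  have h21 : ∀ ε : ℝ, 0 < ε → ε + ζ + ζ < Real.pi → I21 ε = K * ∫ y : ℝ, Q y *
      ∫ x : ℝ, P x * (1 / Complex.sinh ((y : ℂ) - x + ε * Complex.I)) := by
    intro ε hε hε'
    have hpt : ∀ x₁ x₂ : ℝ, Complex.sinh ((x₁ : ℂ) - η / 2) * Complex.sinh ((x₂ : ℂ) + η / 2) /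
          (Complex.sinh η * Complex.sinh ((x₂ : ℂ) - (x₁ : ℂ) + 2 * η + Complex.I * (ε : ℂ))) *
          (rho ζ x₁ : ℂ) * (rho ζ x₂ : ℂ)
        = K * (Q x₁ *
          (P x₂ * (1 / Complex.sinh ((x₂ : ℂ) - x₁ + (ε + ζ + ζ : ℝ) * Complex.I)))) := by
      intro x₁ x₂
      have e : (x₂ : ℂ) - (x₁ : ℂ) + 2 * η + Complex.I * (ε : ℂ)
          = (x₂ : ℂ) - x₁ + (ε + ζ + ζ : ℝ) * Complex.I := by
        rw [hη]
        push_cast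
        ring
      rw [e, mul_comm (Complex.sinh (x₁ - η / 2)), mul_right_comm,
        hprod _ _ _ _ _ _ _ (hrhoP x₂) (hrhoQ x₁)]
      ring
    have hshift := integral_sinhRatio_div_sinh hζ0 hζ1 (c := ε + ζ) (by linarith) hε'
    have hshift' := integral_sinhRatio_div_sinh_reflect hζ0 hζ1 hε (by linarith)
    simp only [hP, hQ] at hshift hshift'
    have hsinc : Real.sin (ε + ζ) ≠ 0 :=
      (Real.sin_pos_of_pos_of_lt_pi (by linarith) (by linarith)).ne'
    have hswap := integral_integral_sinh_swap hQi hQi hsinc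
    simp only [mul_assoc, integral_const_mul] at hswap
    rw [hI21]
    simp only [hpt, integral_const_mul, hshift]
    rw [hswap]
    congr 2
    ext y
    rw [← hshift', ← integral_const_mul]
    congr 1
    ext x
    ring
  have hval := integral_sinhRatio_mul_sinhRatio hζ0 hζ1
  simp only [hP, hQ] at hval
  have hlim := (tendsto_integral_mul_inv_sinh_sub hPc hM hQi).const_mul K
  rw [hval] at hlim
  have hconst : K * (2 * Real.pi * Complex.I *
      ((Real.pi / ζ * (ζ / Real.sin ζ - Real.cos ζ) : ℝ) : ℂ))
      = (((ζ - Real.sin ζ * Real.cos ζ) / (2 * ζ * Real.sin ζ ^ 2) : ℝ) : ℂ) := by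
    have := Complex.I_ne_zero
    simp only [K, hsinh]
    push_cast
    field_simp
    norm_num
  rw [hconst] at hlim
  refine hlim.congr' ?_
  filter_upwards [Ioo_mem_nhdsGT (show 0 < Real.pi - 2 * ζ by linarith)] with ε hε
  obtain ⟨hε0, hε1⟩ := hε
  have hs : Real.sin ε ≠ 0 := (Real.sin_pos_of_pos_of_lt_pi hε0 (by linarith)).ne'
  have hs' : Real.sin (-ε) ≠ 0 := by simpa using hs
  rw [h12 ε hs, h21 ε hε0 (by linarith), ← mul_sub, ← integral_sub]
  · congr 2
    ext y
    rw [← mul_sub, ← integral_sub (integrable_mul_inv_sinh hPi hs' y)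
      (integrable_mul_inv_sinh hPi hs y)]
    simp only [mul_sub]
  · exact integrable_mul_integral_inv_sinh hPi hQi hs'
  · exact integrable_mul_integral_inv_sinh hPi hQi hs
end

section
/- One-point function ⟨E^{0,0}⟩ of the integrable spin-1 XXZ chain (explicit evaluation): Let 0 < ζ < π/2, put η = iζ and ρ(x) = 1/(2ζ cosh(πx/ζ)). For ε > 0 define I₁(ε) = ∫_ℝ∫_ℝ [sinh(x₁−3η/2) sinh(x₂−η/2) / (sinh η · sinh(x₂−x₁−iε))] ρ(x₁) ρ(x₂) dx₁ dx₂ and I₂(ε) = ∫_ℝ∫_ℝ [sinh(x₁−5η/2) sinh(x₂+η/2) / (sinh η · sinh(x₂−x₁+2η+iε))] ρ(x₁) ρ(x₂) dx₁ dx₂. Then the limit lim_{ε→0⁺}(I₁(ε) − I₂(ε)) exists, and lim_{ε→0⁺}(I₁(ε) − I₂(ε)) + 1 − 2 cos ζ ∫_ℝ ρ(x) sinh(x+η/2)/sinh(x+3η/2) dx = (ζ − sin ζ cos ζ)/(2 ζ sin² ζ). In particular ⟨E^{0,0}⟩ = ⟨E^{2,2}⟩. -/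
open MeasureTheory Filter

section
open Complex Asymptotics Topology

theorem normSq_sinh_eq (w : ℂ) :
    normSq (sinh w) = Real.sinh w.re ^ 2 + Real.sin w.im ^ 2 := by
  have h : sinh w = ((Real.sinh w.re * Real.cos w.im : ℝ) : ℂ)
      + ((Real.cosh w.re * Real.sin w.im : ℝ) : ℂ) * I := by
    conv_lhs => rw [← re_add_im w]
    rw [sinh_add, sinh_mul_I, cosh_mul_I]
    push_cast
    ring
  rw [h, normSq_add_mul_I]
  nlinarith [Real.sin_sq_add_cos_sq w.im, Real.cosh_sq w.re]

theorem cosh_eq_sinh_add (w : ℂ) : cosh w = -I * sinh (w + Real.pi / 2 * I) := by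
  rw [sinh_add, cosh_mul_I, sinh_mul_I, cos_pi_div_two, sin_pi_div_two]
  linear_combination cosh w * I_mul_I

theorem norm_cosh_eq (w : ℂ) : ‖cosh w‖ = ‖sinh (w + Real.pi / 2 * I)‖ := by
  rw [cosh_eq_sinh_add]; simp

theorem abs_sin_im_le_norm_sinh_s2 (w : ℂ) : |Real.sin w.im| ≤ ‖sinh w‖ := by
  rw [Complex.norm_def, normSq_sinh_eq]
  exact Real.abs_le_sqrt (by nlinarith [sq_nonneg (Real.sinh w.re)])

theorem abs_sinh_re_le_norm_sinh_s2 (w : ℂ) : |Real.sinh w.re| ≤ ‖sinh w‖ := by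
  rw [Complex.norm_def, normSq_sinh_eq]
  exact Real.abs_le_sqrt (by nlinarith [sq_nonneg (Real.sin w.im)])

theorem norm_sinh_le_cosh_re_s2 (w : ℂ) : ‖sinh w‖ ≤ Real.cosh w.re := by
  rw [Complex.norm_def, normSq_sinh_eq]
  refine (Real.sqrt_le_left (Real.cosh_pos _).le).2 ?_
  nlinarith [Real.sin_sq_le_one w.im, Real.cosh_sq w.re]

theorem sinh_eq_zero_iff_of_abs_im_lt {w : ℂ} (hw : |w.im| < Real.pi) : sinh w = 0 ↔ w = 0 := by
  refine ⟨fun h => ?_, fun h => by rw [h, sinh_zero]⟩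
  have h1 := abs_sin_im_le_norm_sinh_s2 w
  have h2 := abs_sinh_re_le_norm_sinh_s2 w
  rw [h, norm_zero, abs_nonpos_iff] at h1 h2
  obtain ⟨h3, h4⟩ := abs_lt.1 hw
  exact Complex.ext (Real.sinh_eq_zero.1 h2) ((Real.sin_eq_zero_iff_of_lt_of_lt h3 h4).1 h1)

/-- The filter of complex numbers whose real part tends to infinity in absolute value. -/
def farReal : Filter ℂ := comap (fun z : ℂ => |z.re|) atTop

theorem eventually_farReal_re_ne (r : ℝ) : ∀ᶠ z : ℂ in farReal, z.re ≠ r := by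
  have : ∀ᶠ z : ℂ in farReal, |r| < |z.re| := tendsto_comap.eventually (eventually_gt_atTop _)
  filter_upwards [this] with z hz h
  rw [h] at hz
  exact lt_irrefl _ hz

theorem cosh_le_exp_abs (x : ℝ) : Real.cosh x ≤ Real.exp |x| := by
  rw [← Real.cosh_abs, Real.cosh_eq]
  have : Real.exp (-|x|) ≤ Real.exp |x| := Real.exp_le_exp.2 (by linarith [abs_nonneg x])
  linarith

theorem isBigO_sinh (a : ℝ) (β : ℂ) :
    (fun z : ℂ => sinh (a * z + β)) =O[farReal] fun z => Real.exp (|a| * |z.re|) := by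
  refine IsBigO.of_bound (Real.exp |β.re|) (Eventually.of_forall fun z => ?_)
  refine (norm_sinh_le_cosh_re_s2 _).trans ((cosh_le_exp_abs _).trans ?_)
  rw [Real.norm_eq_abs, Real.abs_exp, ← Real.exp_add]
  refine Real.exp_le_exp.2 ?_
  have : ((a : ℂ) * z + β).re = a * z.re + β.re := by simp
  rw [this, ← abs_mul, add_comm]
  exact (abs_add_le _ _).trans (by rw [add_comm])

theorem isBigO_inv_sinh {a : ℝ} (ha : a ≠ 0) (β : ℂ) :
    (fun z : ℂ => (sinh (a * z + β))⁻¹) =O[farReal] fun z => Real.exp (-|a| * |z.re|) := by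
  have ha' : 0 < |a| := abs_pos.2 ha
  refine IsBigO.of_bound (4 * Real.exp |β.re|) ?_
  have h : ∀ᶠ z : ℂ in farReal, (|β.re| + 1) / |a| ≤ |z.re| :=
    tendsto_comap.eventually (eventually_ge_atTop _)
  filter_upwards [h] with z hz
  have h1 : |β.re| + 1 ≤ |a| * |z.re| := by rwa [div_le_iff₀' ha'] at hz
  have h2 : Real.exp (|a| * |z.re| - |β.re|) / 4 ≤ ‖sinh (a * z + β)‖ := by
    refine le_trans ?_ (abs_sinh_re_le_norm_sinh_s2 _)
    have : ((a : ℂ) * z + β).re = a * z.re + β.re := by simp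
    rw [this, Real.abs_sinh]
    have h3 : |a| * |z.re| - |β.re| ≤ |a * z.re + β.re| := by
      rw [← abs_mul]
      have := abs_add_le (a * z.re + β.re) (-β.re)
      simp at this
      rw [← abs_mul] at this
      linarith
    refine le_trans ?_ (Real.sinh_le_sinh.2 h3)
    set t := |a| * |z.re| - |β.re| with ht
    have ht1 : 1 ≤ t := by linarith
    rw [Real.sinh_eq]
    have e1 : 2 ≤ Real.exp t := by linarith [Real.add_one_le_exp t]
    have e2 : Real.exp (-t) ≤ 1 := Real.exp_le_one_iff.2 (by linarith)
    linarith
  rw [norm_inv, Real.norm_eq_abs, Real.abs_exp]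
  have h4 : (0 : ℝ) < Real.exp (|a| * |z.re| - |β.re|) / 4 := by positivity
  refine (inv_anti₀ h4 h2).trans (le_of_eq ?_)
  rw [inv_div, Real.exp_sub, neg_mul, Real.exp_neg]
  field_simp

theorem isBigO_inv_cosh {a : ℝ} (ha : a ≠ 0) :
    (fun z : ℂ => (cosh (a * z))⁻¹) =O[farReal] fun z => Real.exp (-|a| * |z.re|) := by
  refine (IsBigO.of_norm_left ?_)
  simpa only [norm_inv, norm_cosh_eq] using (isBigO_inv_sinh ha (Real.pi / 2 * I)).norm_left

theorem integrable_exp_neg_mul_abs {c : ℝ} (hc : 0 < c) :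
    Integrable fun x : ℝ => Real.exp (-c * |x|) := by
  have h := integrableOn_exp_mul_Ioi (neg_lt_zero.2 hc) 0
  rw [← integrableOn_univ, ← Set.Iic_union_Ioi (a := (0 : ℝ))]
  have h1 : IntegrableOn (fun x : ℝ => Real.exp (-c * |x|)) (Set.Ioi 0) :=
    h.congr_fun (fun x hx => by simp only [abs_of_pos (Set.mem_Ioi.1 hx)]) measurableSet_Ioi
  refine IntegrableOn.union ?_ h1
  rw [integrableOn_Iic_iff_integrableOn_Iio]
  have := h1.comp_neg
  simpa using this

theorem tendsto_line_farReal (a : ℝ) :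
    Tendsto (fun x : ℝ => (x : ℂ) + a * I) (cocompact ℝ) farReal := by
  rw [farReal, tendsto_comap_iff]
  have h := tendsto_norm_cocompact_atTop (E := ℝ)
  refine h.congr fun x => ?_
  simp

theorem integrable_line {f : ℂ → ℂ} {S : Set ℂ} (hf : ContinuousOn f S) {a c : ℝ}
    (hS : ∀ x : ℝ, (x : ℂ) + a * I ∈ S) (hc : 0 < c)
    (ho : f =O[farReal] fun z => Real.exp (-c * |z.re|)) :
    Integrable fun x : ℝ => f (x + a * I) := by
  have hcont : Continuous fun x : ℝ => f (x + a * I) :=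
    hf.comp_continuous (by fun_prop) hS
  refine hcont.locallyIntegrable.integrable_of_isBigO_cocompact
    (g := fun x : ℝ => Real.exp (-c * |x|)) ?_ (integrable_exp_neg_mul_abs hc |>.integrableAtFilter _)
  simpa [Function.comp_def] using ho.comp_tendsto (tendsto_line_farReal a)

theorem tendsto_vertical_integral {f : ℂ → ℂ} {a b c : ℝ} (hc : 0 < c)
    (ho : f =O[farReal] fun z => Real.exp (-c * |z.re|)) {l : Filter ℝ} {u : ℝ → ℝ}
    (hu : Tendsto (fun t => |u t|) l atTop) :
    Tendsto (fun t => ∫ y : ℝ in a..b, f (u t + y * I)) l (𝓝 0) := by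
  obtain ⟨C, hC⟩ := ho.bound
  rw [farReal, eventually_comap] at hC
  have h1 : ∀ᶠ t in l, ‖∫ y : ℝ in a..b, f (u t + y * I)‖
      ≤ C * Real.exp (-c * |u t|) * |b - a| := by
    filter_upwards [hu.eventually hC] with t ht
    refine intervalIntegral.norm_integral_le_of_norm_le_const fun y _ => ?_
    simpa using ht (u t + y * I) (by simp)
  refine squeeze_zero_norm' h1 ?_
  have h2 : Tendsto (fun t => Real.exp (-c * |u t|)) l (𝓝 0) := by
    refine Real.tendsto_exp_atBot.comp ?_
    exact hu.const_mul_atTop_of_neg (neg_lt_zero.2 hc)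
  simpa using (h2.const_mul C).mul_const |b - a|

theorem integral_line_eq {f : ℂ → ℂ} {a b c : ℝ}
    (hf : DifferentiableOn ℂ f {z | z.im ∈ Set.uIcc a b}) (hc : 0 < c)
    (ho : f =O[farReal] fun z => Real.exp (-c * |z.re|)) :
    ∫ x : ℝ, f (x + a * I) = ∫ x : ℝ, f (x + b * I) := by
  have ia := integrable_line hf.continuousOn (a := a) (fun x => by simp) hc ho
  have ib := integrable_line hf.continuousOn (a := b) (fun x => by simp) hc ho
  have ta := intervalIntegral_tendsto_integral ia tendsto_neg_atTop_atBot tendsto_id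
  have tb := intervalIntegral_tendsto_integral ib tendsto_neg_atTop_atBot tendsto_id
  have tr := tendsto_vertical_integral (a := a) (b := b) hc ho (u := id) tendsto_abs_atTop_atTop
  have tl := tendsto_vertical_integral (a := a) (b := b) hc ho (u := fun t => -t)
    (by simpa using tendsto_abs_atTop_atTop)
  have t := ((ta.sub tb).add (tr.const_smul I)).sub (tl.const_smul I)
  have z : ∀ T : ℝ, (∫ x : ℝ in -T..T, f (x + a * I)) - (∫ x : ℝ in -T..T, f (x + b * I)) +
      I • (∫ y : ℝ in a..b, f (T + y * I)) -
      I • (∫ y : ℝ in a..b, f ((-T : ℝ) + y * I)) = 0 := by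
    intro T
    have := integral_boundary_rect_eq_zero_of_differentiableOn f ⟨-T, a⟩ ⟨T, b⟩
      (hf.mono fun z hz => hz.2)
    simpa using this
  have := tendsto_nhds_unique (t.congr fun T => z T) tendsto_const_nhds
  simpa [sub_eq_zero] using this

theorem exists_differentiableOn_div {F q : ℂ → ℂ} {S : Set ℂ} {w F' q' : ℂ} (hS : S ∈ 𝓝 w)
    (hF : DifferentiableOn ℂ F S) (hq : DifferentiableOn ℂ q S) (hFw : F w = 0)
    (hqw : ∀ z ∈ S, q z = 0 ↔ z = w) (hF' : HasDerivAt F F' w) (hq' : HasDerivAt q q' w)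
    (hq0 : q' ≠ 0) :
    ∃ G : ℂ → ℂ, DifferentiableOn ℂ G S ∧ (∀ z, z ≠ w → G z = F z / q z) ∧ G w = F' / q' := by
  have hqw0 : q w = 0 := (hqw w (mem_of_mem_nhds hS)).2 rfl
  refine ⟨fun z => dslope F w z / dslope q w z, ?_, ?_, ?_⟩
  · refine ((differentiableOn_dslope hS).2 hF).div ((differentiableOn_dslope hS).2 hq) ?_
    intro z hz
    by_cases h : z = w
    · rw [h, dslope_same, hq'.deriv]; exact hq0
    · rw [dslope_of_ne _ h, slope_def_field, hqw0, sub_zero]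
      exact div_ne_zero (fun h' => h ((hqw z hz).1 h')) (sub_ne_zero.2 h)
  · intro z h
    beta_reduce
    rw [dslope_of_ne _ h, dslope_of_ne _ h, slope_def_field, slope_def_field, hqw0, hFw,
      sub_zero, sub_zero, div_div_div_cancel_right₀ (sub_ne_zero.2 h)]
  · simp only [dslope_same, hF'.deriv, hq'.deriv]


theorem integral_inv_cosh {c : ℝ} (hc : 0 < c) :
    ∫ x : ℝ, (cosh (c * x : ℂ))⁻¹ = Real.pi / c := by
  have h0 : ∀ x : ℝ, (cosh (c * x : ℂ))⁻¹ = (((Real.cosh (c * x))⁻¹ : ℝ) : ℂ) := fun x => by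
    push_cast; rfl
  have hd : Differentiable ℂ fun z : ℂ => cosh (c * z) := by fun_prop
  have hi : Integrable fun x : ℝ => (cosh (c * x : ℂ))⁻¹ := by
    have hS : ContinuousOn (fun z : ℂ => (cosh (c * z))⁻¹) {z | z.im = 0} := by
      refine hd.continuous.continuousOn.inv₀ fun z hz => ?_
      have : z = (z.re : ℂ) := Complex.ext rfl (by simpa using hz)
      rw [this, ← ofReal_mul, ← ofReal_cosh]
      exact ofReal_ne_zero.2 (Real.cosh_pos _).ne'
    simpa using integrable_line hS (a := 0) (by simp) (abs_pos.2 hc.ne') (isBigO_inv_cosh hc.ne')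
  simp only [h0] at hi ⊢
  rw [integral_complex_ofReal]
  have hi' : Integrable fun x : ℝ => (Real.cosh (c * x))⁻¹ := hi.re
  have hder : ∀ x : ℝ, HasDerivAt (fun x => 2 / c * Real.arctan (Real.exp (c * x)))
      (Real.cosh (c * x))⁻¹ x := by
    intro x
    have h1 : HasDerivAt (fun x : ℝ => c * x) c x := by
      simpa using (hasDerivAt_id x).const_mul c
    refine (h1.exp.arctan.const_mul (2 / c)).congr_deriv ?_
    rw [Real.cosh_eq, Real.exp_neg]
    have := Real.exp_pos (c * x)
    field_simp
    ring
  have hlin : Tendsto (fun x : ℝ => c * x) atTop atTop := tendsto_id.const_mul_atTop hc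
  have hlin' : Tendsto (fun x : ℝ => c * x) atBot atBot := tendsto_id.const_mul_atBot hc
  have ht : Tendsto (fun x : ℝ => 2 / c * Real.arctan (Real.exp (c * x))) atTop
      (𝓝 (2 / c * (Real.pi / 2))) :=
    ((tendsto_nhds_of_tendsto_nhdsWithin Real.tendsto_arctan_atTop).comp
      (Real.tendsto_exp_atTop.comp hlin)).const_mul _
  have hb : Tendsto (fun x : ℝ => 2 / c * Real.arctan (Real.exp (c * x))) atBot
      (𝓝 (2 / c * Real.arctan 0)) :=
    ((Real.continuous_arctan.tendsto 0).comp
      (Real.tendsto_exp_atBot.comp hlin')).const_mul _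
  rw [integral_of_hasDerivAt_of_tendsto hder hi' hb ht, Real.arctan_zero]
  push_cast
  field_simp
  ring

theorem integral_inv_cosh_sq {c : ℝ} (hc : 0 < c) :
    Integrable (fun x : ℝ => (cosh (c * x : ℂ) ^ 2)⁻¹) ∧
      ∫ x : ℝ, (cosh (c * x : ℂ) ^ 2)⁻¹ = 2 / c := by
  have h0 : ∀ x : ℝ, (cosh (c * x : ℂ) ^ 2)⁻¹ = (((Real.cosh (c * x) ^ 2)⁻¹ : ℝ) : ℂ) := fun x => by
    push_cast; rfl
  have hd : Differentiable ℂ fun z : ℂ => cosh (c * z) ^ 2 := by fun_prop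
  have hi : Integrable fun x : ℝ => (cosh (c * x : ℂ) ^ 2)⁻¹ := by
    have hS : ContinuousOn (fun z : ℂ => (cosh (c * z) ^ 2)⁻¹) {z | z.im = 0} := by
      refine hd.continuous.continuousOn.inv₀ fun z hz => ?_
      have : z = (z.re : ℂ) := Complex.ext rfl (by simpa using hz)
      rw [this, ← ofReal_mul, ← ofReal_cosh]
      exact pow_ne_zero 2 (ofReal_ne_zero.2 (Real.cosh_pos _).ne')
    have ho : (fun z : ℂ => (cosh (c * z) ^ 2)⁻¹) =O[farReal]
        fun z => Real.exp (-(2 * |c|) * |z.re|) :=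
      ((isBigO_inv_cosh hc.ne').mul (isBigO_inv_cosh hc.ne')).congr
        (fun z => by rw [← mul_inv, pow_two]) (fun z => by rw [← Real.exp_add]; ring_nf)
    simpa using integrable_line hS (a := 0) (by simp) (mul_pos two_pos (abs_pos.2 hc.ne')) ho
  refine ⟨hi, ?_⟩
  simp only [h0] at hi ⊢
  rw [integral_complex_ofReal]
  have hi' : Integrable fun x : ℝ => (Real.cosh (c * x) ^ 2)⁻¹ := hi.re
  have hder : ∀ x : ℝ, HasDerivAt (fun x => -(2 / c) * (1 + Real.exp (2 * c * x))⁻¹)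
      (Real.cosh (c * x) ^ 2)⁻¹ x := by
    intro x
    have h1 : HasDerivAt (fun x : ℝ => 2 * c * x) (2 * c) x := by
      simpa using (hasDerivAt_id x).const_mul (2 * c)
    have hp := Real.exp_pos (c * x)
    have h2 : Real.exp (2 * c * x) = Real.exp (c * x) ^ 2 := by
      rw [← Real.exp_nat_mul]; push_cast; ring_nf
    refine (((h1.exp.const_add 1).inv (by positivity)).const_mul (-(2 / c))).congr_deriv ?_
    rw [Real.cosh_eq, Real.exp_neg, h2]
    field_simp
    ring
  have hlin : Tendsto (fun x : ℝ => 2 * c * x) atTop atTop :=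
    tendsto_id.const_mul_atTop (by positivity)
  have hlin' : Tendsto (fun x : ℝ => 2 * c * x) atBot atBot :=
    tendsto_id.const_mul_atBot (by positivity)
  have ht : Tendsto (fun x : ℝ => -(2 / c) * (1 + Real.exp (2 * c * x))⁻¹) atTop
      (𝓝 (-(2 / c) * 0)) :=
    (tendsto_inv_atTop_zero.comp (tendsto_atTop_add_const_left _ 1
      (Real.tendsto_exp_atTop.comp hlin))).const_mul _
  have hb : Tendsto (fun x : ℝ => -(2 / c) * (1 + Real.exp (2 * c * x))⁻¹) atBot
      (𝓝 (-(2 / c) * (1 + 0)⁻¹)) :=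
    (((Real.tendsto_exp_atBot.comp hlin').const_add 1).inv₀ (by norm_num)).const_mul _
  rw [integral_of_hasDerivAt_of_tendsto hder hi' hb ht]
  push_cast
  ring

/-- The closed horizontal strip `0 ≤ Im z ≤ b`. -/
def hstrip (b : ℝ) : Set ℂ := {z | z.im ∈ Set.Icc 0 b}

theorem hstrip_mem_nhds {b : ℝ} {p : ℂ} (h0 : 0 < p.im) (hb : p.im < b) : hstrip b ∈ 𝓝 p :=
  continuous_im.continuousAt.preimage_mem_nhds (Icc_mem_nhds h0 hb)

theorem sinh_pi_div_eq_zero_iff {b : ℝ} {p z : ℂ} (h0 : 0 < p.im) (hb : p.im < b)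
    (hz : z ∈ hstrip b) : sinh ((Real.pi / b : ℝ) * (z - p)) = 0 ↔ z = p := by
  have hb0 : 0 < b := h0.trans hb
  rw [sinh_eq_zero_iff_of_abs_im_lt]
  · simp [sub_eq_zero, Real.pi_ne_zero, hb0.ne']
  · rw [im_ofReal_mul, sub_im, abs_mul, abs_of_pos (by positivity), div_mul_eq_mul_div,
      div_lt_iff₀ hb0]
    refine mul_lt_mul_of_pos_left ?_ Real.pi_pos
    rw [abs_lt]
    constructor <;> linarith [hz.1, hz.2]

theorem isBigO_inv_sinh_sub {a : ℝ} (ha : a ≠ 0) (p : ℂ) :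
    (fun z : ℂ => (sinh (a * (z - p)))⁻¹) =O[farReal] fun z => Real.exp (-|a| * |z.re|) := by
  refine (isBigO_inv_sinh ha (-(a * p))).congr_left fun z => ?_
  rw [mul_sub, sub_eq_add_neg]

theorem integral_inv_sinh {b : ℝ} {p : ℂ} (h0 : 0 < p.im) (hb : p.im < b) :
    ∫ x : ℝ, (sinh ((Real.pi / b : ℝ) * (x - p)))⁻¹ = I * b := by
  have hb0 : 0 < b := h0.trans hb
  have hc : 0 < Real.pi / b := by positivity
  have key := integral_line_eq (f := fun z => (sinh ((Real.pi / b : ℝ) * (z - p)))⁻¹)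
    (a := 0) (b := p.im - b / 2) ?_ (abs_pos.2 hc.ne') (isBigO_inv_sinh_sub hc.ne' p)
  · simp only [ofReal_zero, zero_mul, add_zero] at key
    rw [key]
    have h1 : ∀ x : ℝ, (sinh ((Real.pi / b : ℝ) * (x + (p.im - b / 2 : ℝ) * I - p)))⁻¹
        = I * (cosh ((Real.pi / b : ℝ) * (x - p.re : ℝ)))⁻¹ := by
      intro x
      have hp : p = p.re + p.im * I := (re_add_im p).symm
      have : ((Real.pi / b : ℝ) : ℂ) * (x + (p.im - b / 2 : ℝ) * I - p)
          = (Real.pi / b : ℝ) * (x - p.re : ℝ) - Real.pi / 2 * I := by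
        push_cast
        have : (b : ℂ) ≠ 0 := ofReal_ne_zero.2 hb0.ne'
        field_simp
        linear_combination (-2) * hp
      rw [this, sinh_sub, cosh_mul_I, sinh_mul_I, cos_pi_div_two, sin_pi_div_two, mul_zero,
        zero_sub, one_mul, inv_neg, mul_inv, inv_I]
      ring
    simp only [h1]
    rw [integral_const_mul, integral_sub_right_eq_self
      (fun x : ℝ => (cosh ((Real.pi / b : ℝ) * x))⁻¹) p.re, integral_inv_cosh hc]
    push_cast
    have : (Real.pi : ℂ) ≠ 0 := ofReal_ne_zero.2 Real.pi_ne_zero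
    field_simp
  · refine DifferentiableOn.inv (by fun_prop) fun z hz => ?_
    have hz1 : z.im < p.im ∧ p.im - b < z.im := by
      rcases Set.mem_uIcc.1 hz with h | h <;> constructor <;> linarith [h.1, h.2]
    have := (sinh_eq_zero_iff_of_abs_im_lt (w := (Real.pi / b : ℝ) * (z - p)) ?_).not.2 ?_
    · exact this
    · rw [im_ofReal_mul, sub_im, abs_mul, abs_of_pos hc, div_mul_eq_mul_div,
        div_lt_iff₀ hb0]
      refine mul_lt_mul_of_pos_left ?_ Real.pi_pos
      rw [abs_lt]
      constructor <;> linarith [hz1.1, hz1.2]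
    · refine mul_ne_zero (ofReal_ne_zero.2 hc.ne') fun h => ?_
      have := congrArg im h
      rw [sub_im, zero_im] at this
      linarith [hz1.1]

/-- Residue theorem on the strip `0 ≤ Im z ≤ b` for a function with a single simple pole `p`,
written as a quotient by `sinh (π (z - p) / b)`. -/
theorem integral_sub_integral_strip {b c : ℝ} {p : ℂ} (h0 : 0 < p.im) (hb : p.im < b)
    {f Ψ : ℂ → ℂ} (hΨ : DifferentiableOn ℂ Ψ (hstrip b)) (hc : 0 < c)
    (hf : ∀ z : ℂ, z.im = 0 ∨ z.im = b → f z = Ψ z * (sinh ((Real.pi / b : ℝ) * (z - p)))⁻¹)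
    (hfar : f =ᶠ[farReal] fun z => Ψ z * (sinh ((Real.pi / b : ℝ) * (z - p)))⁻¹)
    (ho : f =O[farReal] fun z => Real.exp (-c * |z.re|)) :
    Integrable (fun x : ℝ => f x) ∧ Integrable (fun x : ℝ => f (x + b * I)) ∧
      (∫ x : ℝ, f x) - ∫ x : ℝ, f (x + b * I) = 2 * I * b * Ψ p := by
  have hb0 : 0 < b := h0.trans hb
  set a := Real.pi / b with ha
  have ha0 : 0 < a := by positivity
  have hab : a * b = Real.pi := by rw [ha]; field_simp
  have hderiv : HasDerivAt (fun z : ℂ => sinh (a * (z - p))) a p := by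
    have h1 : HasDerivAt (fun z : ℂ => (a : ℂ) * (z - p)) a p := by
      simpa using ((hasDerivAt_id p).sub_const p).const_mul (a : ℂ)
    simpa using h1.csinh
  have hmem : hstrip b ∈ 𝓝 p := hstrip_mem_nhds h0 hb
  obtain ⟨G, hG, hGz, -⟩ := exists_differentiableOn_div (F := fun z => Ψ z - Ψ p)
    (q := fun z => sinh (a * (z - p))) hmem (hΨ.sub_const _) (by fun_prop) (sub_self _)
    (fun z hz => sinh_pi_div_eq_zero_iff h0 hb hz)
    ((hΨ.differentiableAt hmem).hasDerivAt.sub_const _) hderiv (ofReal_ne_zero.2 ha0.ne')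
  have hGf : ∀ z, z ≠ p → G z = Ψ z * (sinh (a * (z - p)))⁻¹
      - Ψ p * (sinh (a * (z - p)))⁻¹ := fun z hz => by
    rw [hGz z hz]; ring
  set d := min c a with hd
  have hd0 : 0 < d := lt_min hc ha0
  have hexp : ∀ {e : ℝ}, d ≤ e → (fun z : ℂ => Real.exp (-e * |z.re|)) =O[farReal]
      fun z => Real.exp (-d * |z.re|) := fun {e} he => by
    refine IsBigO.of_bound 1 (Eventually.of_forall fun z => ?_)
    simp only [Real.norm_eq_abs, Real.abs_exp, one_mul]
    refine Real.exp_le_exp.2 ?_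
    nlinarith [abs_nonneg z.re]
  have hko : (fun z : ℂ => (sinh (a * (z - p)))⁻¹) =O[farReal]
      fun z => Real.exp (-d * |z.re|) := by
    have := isBigO_inv_sinh_sub ha0.ne' p
    rw [abs_of_pos ha0] at this
    exact this.trans (hexp (min_le_right _ _))
  have hGo : G =O[farReal] fun z => Real.exp (-d * |z.re|) := by
    refine (((ho.trans (hexp (min_le_left _ _))).sub (hko.const_mul_left (Ψ p)))).congr' ?_
      EventuallyEq.rfl
    filter_upwards [eventually_farReal_re_ne p.re, hfar] with z hz hfz
    rw [hfz, hGf z (fun h => hz (by rw [h]))]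
  have hl0 : ∀ x : ℝ, (x : ℂ) ≠ p := fun x h => by
    have := congrArg im h
    simp at this
    linarith
  have hlb : ∀ x : ℝ, (x : ℂ) + b * I ≠ p := fun x h => by
    have := congrArg im h
    simp at this
    linarith
  have hs0 : ∀ x : ℝ, (x : ℂ) + (0 : ℝ) * I ∈ hstrip b := fun x => by simp [hstrip, hb0.le]
  have hsb : ∀ x : ℝ, (x : ℂ) + b * I ∈ hstrip b := fun x => by simp [hstrip, hb0.le]
  have iG0 : Integrable fun x : ℝ => G x := by
    simpa using integrable_line hG.continuousOn hs0 hd0 hGo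
  have iGb := integrable_line hG.continuousOn hsb hd0 hGo
  have hshift : ∀ x : ℝ, (sinh (a * (x + b * I - p)))⁻¹ = -(sinh (a * (x - p)))⁻¹ := fun x => by
    have : (a : ℂ) * (x + b * I - p) = a * (x - p) + Real.pi * I := by
      rw [← hab]; push_cast; ring
    rw [this, sinh_add, cosh_mul_I, sinh_mul_I, cos_pi, sin_pi]
    simp
  have ik : Integrable fun x : ℝ => (sinh (a * ((x : ℂ) - p)))⁻¹ := by
    have hcont : ContinuousOn (fun z : ℂ => (sinh (a * (z - p)))⁻¹) {z | z.im = 0} := by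
      refine ContinuousOn.inv₀ (by fun_prop) fun z hz => ?_
      have hz' : z.im = 0 := hz
      refine (sinh_pi_div_eq_zero_iff h0 hb (by simp [hstrip, hz', hb0.le])).not.2 fun h => ?_
      rw [h] at hz'
      linarith
    simpa using integrable_line hcont (a := 0) (by simp) hd0 hko
  have ef0 : ∀ x : ℝ, f x = G x + Ψ p * (sinh (a * ((x : ℂ) - p)))⁻¹ := fun x => by
    rw [hGf _ (hl0 x), hf _ (Or.inl (by simp))]; ring
  have efb : ∀ x : ℝ, f (x + b * I) = G (x + b * I) - Ψ p * (sinh (a * ((x : ℂ) - p)))⁻¹ :=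
    fun x => by rw [hGf _ (hlb x), hf _ (Or.inr (by simp)), hshift]; ring
  have hG_eq := integral_line_eq (f := G) (a := 0) (b := b)
    (by rwa [Set.uIcc_of_le hb0.le]) hd0 hGo
  simp only [ofReal_zero, zero_mul, add_zero] at hG_eq
  simp only [ef0, efb]
  refine ⟨iG0.add (ik.const_mul _), iGb.sub (ik.const_mul _), ?_⟩
  rw [integral_add iG0 (ik.const_mul _), integral_sub iGb (ik.const_mul _), integral_const_mul,
    integral_inv_sinh h0 hb, hG_eq]
  ring

end

section
open Complex Asymptotics Topology

/-- The meromorphic continuation of `rho`. -/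
noncomputable def rhoC (ζ : ℝ) (z : ℂ) : ℂ := (2 * ζ * cosh ((Real.pi / ζ : ℝ) * z))⁻¹

theorem ofReal_rho (ζ x : ℝ) : (rho ζ x : ℂ) = rhoC ζ x := by
  rw [rho, rhoC, one_div]
  push_cast
  rw [div_mul_eq_mul_div]

theorem cosh_pi_div_mul {ζ : ℝ} (hζ : ζ ≠ 0) (z : ℂ) :
    cosh ((Real.pi / ζ : ℝ) * z) = I * sinh ((Real.pi / ζ : ℝ) * (z - ζ / 2 * I)) := by
  have hζ' : (ζ : ℂ) ≠ 0 := ofReal_ne_zero.2 hζ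
  have : ((Real.pi / ζ : ℝ) : ℂ) * (z - ζ / 2 * I)
      = (Real.pi / ζ : ℝ) * z - Real.pi / 2 * I := by
    push_cast; field_simp
  rw [this, sinh_sub, cosh_mul_I, sinh_mul_I, cos_pi_div_two, sin_pi_div_two]
  linear_combination cosh ((Real.pi / ζ : ℝ) * z) * I_mul_I

theorem rhoC_eq {ζ : ℝ} (hζ : ζ ≠ 0) (z : ℂ) :
    rhoC ζ z = (2 * ζ * I)⁻¹ * (sinh ((Real.pi / ζ : ℝ) * (z - ζ / 2 * I)))⁻¹ := by
  rw [rhoC, cosh_pi_div_mul hζ, ← mul_inv]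
  ring_nf

theorem rhoC_add {ζ : ℝ} (hζ : ζ ≠ 0) (z : ℂ) : rhoC ζ (z + ζ * I) = -rhoC ζ z := by
  have hζ' : (ζ : ℂ) ≠ 0 := ofReal_ne_zero.2 hζ
  have : ((Real.pi / ζ : ℝ) : ℂ) * (z + ζ * I) = (Real.pi / ζ : ℝ) * z + Real.pi * I := by
    push_cast; field_simp
  rw [rhoC, rhoC, this, cosh_add, cosh_mul_I, sinh_mul_I, cos_pi, sin_pi]
  rw [← inv_neg]
  ring_nf

theorem isBigO_rhoC {ζ : ℝ} (hζ : 0 < ζ) :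
    rhoC ζ =O[farReal] fun z => Real.exp (-(Real.pi / ζ) * |z.re|) := by
  have hc : 0 < Real.pi / ζ := by positivity
  have h := (isBigO_inv_cosh hc.ne').const_mul_left (2 * ζ : ℂ)⁻¹
  rw [abs_of_pos hc] at h
  exact h.congr_left fun z => by rw [rhoC, mul_inv (2 * (ζ : ℂ))]

theorem ne_of_im_eq {b : ℝ} {p z : ℂ} (h0 : 0 < p.im) (hb : p.im < b)
    (hz : z.im = 0 ∨ z.im = b) : z ≠ p := by
  rintro rfl
  rcases hz with h | h <;> linarith

theorem mem_hstrip_of_im_eq {b : ℝ} {z : ℂ} (hb : 0 ≤ b) (hz : z.im = 0 ∨ z.im = b) :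
    z ∈ hstrip b := by
  rcases hz with h | h <;> simp [hstrip, h, hb]

theorem sinh_ne_zero_of_re_ne {a : ℝ} (ha : a ≠ 0) {p z : ℂ} (h : z.re ≠ p.re) :
    sinh (a * (z - p)) ≠ 0 := by
  intro h0
  have h1 := abs_sinh_re_le_norm_sinh_s2 (a * (z - p))
  rw [h0, norm_zero, abs_nonpos_iff, Real.sinh_eq_zero, re_ofReal_mul, sub_re] at h1
  rcases mul_eq_zero.1 h1 with h2 | h2
  · exact ha h2
  · exact h (sub_eq_zero.1 h2)

theorem sinh_ne_zero_of_sin_im_ne {w : ℂ} (h : Real.sin w.im ≠ 0) : sinh w ≠ 0 := by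
  intro h0
  have h1 := abs_sin_im_le_norm_sinh_s2 w
  rw [h0, norm_zero, abs_nonpos_iff] at h1
  exact h h1

/-- Shifting the contour through the pole of `rhoC`. -/
theorem integral_mul_rhoC_shift {ζ : ℝ} (hζ : 0 < ζ) {g : ℂ → ℂ}
    (hg : DifferentiableOn ℂ g (hstrip ζ)) (ho : g =O[farReal] fun _ => (1 : ℝ)) :
    ∫ x : ℝ, g x * rhoC ζ x = -(∫ x : ℝ, g (x + ζ * I) * rhoC ζ x) + g (ζ / 2 * I) := by
  have him : ((ζ : ℂ) / 2 * I).im = ζ / 2 := by simp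
  have hc : 0 < Real.pi / ζ := by positivity
  have hf : ∀ z, g z * rhoC ζ z = g z * (2 * ζ * I)⁻¹ *
      (sinh ((Real.pi / ζ : ℝ) * (z - ζ / 2 * I)))⁻¹ := fun z => by
    rw [rhoC_eq hζ.ne']; ring
  obtain ⟨-, -, key⟩ := integral_sub_integral_strip (b := ζ) (p := ζ / 2 * I)
    (f := fun z => g z * rhoC ζ z) (Ψ := fun z => g z * (2 * ζ * I)⁻¹)
    (by rw [him]; linarith) (by rw [him]; linarith) (hg.mul_const _) hc
    (fun z _ => hf z) (Eventually.of_forall hf)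
    ((ho.mul (isBigO_rhoC hζ)).congr_right fun z => one_mul _)
  have h1 : ∀ x : ℝ, g (x + ζ * I) * rhoC ζ (x + ζ * I) = -(g (x + ζ * I) * rhoC ζ x) :=
    fun x => by rw [rhoC_add hζ.ne', mul_neg]
  simp only [h1, integral_neg] at key
  have hζ' : (ζ : ℂ) ≠ 0 := ofReal_ne_zero.2 hζ.ne'
  have h2 : 2 * I * ζ * (g (ζ / 2 * I) * (2 * ζ * I)⁻¹) = g (ζ / 2 * I) := by
    field_simp
  rw [h2] at key
  linear_combination key

theorem isBigO_sinh_add (β : ℂ) :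
    (fun z : ℂ => sinh (z + β)) =O[farReal] fun z => Real.exp |z.re| := by
  simpa using isBigO_sinh 1 β

theorem isBigO_inv_sinh_add (β : ℂ) :
    (fun z : ℂ => (sinh (z + β))⁻¹) =O[farReal] fun z => Real.exp (-|z.re|) := by
  simpa using isBigO_inv_sinh one_ne_zero β

theorem isBigO_sinh_mul_inv_sinh (α β : ℂ) :
    (fun z : ℂ => sinh (z + α) * (sinh (z + β))⁻¹) =O[farReal] fun _ => (1 : ℝ) :=
  ((isBigO_sinh_add α).mul (isBigO_inv_sinh_add β)).congr_right fun z => by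
    rw [← Real.exp_add, add_neg_cancel, Real.exp_zero]

theorem hasDerivAt_sinh_sub (a : ℝ) (p : ℂ) :
    HasDerivAt (fun z : ℂ => sinh (a * (z - p))) a p := by
  have h1 : HasDerivAt (fun z : ℂ => (a : ℂ) * (z - p)) a p := by
    simpa using ((hasDerivAt_id p).sub_const p).const_mul (a : ℂ)
  simpa using h1.csinh

/-- Shifting the contour through a pole of the kernel, the pole of `rhoC` being cancelled. -/
theorem integral_kernel_shift {ζ : ℝ} (hζ : 0 < ζ) (hζπ : ζ < Real.pi) {p : ℂ}
    (h0 : 0 < p.im) (hp : p.im < ζ / 2) :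
    ∫ x : ℝ, sinh (x - ζ / 2 * I) * (sinh (x - p))⁻¹ * rhoC ζ x
      = -(∫ x : ℝ, sinh (x + ζ / 2 * I) * (sinh (x - p + ζ * I))⁻¹ * rhoC ζ x)
        + 2 * Real.pi * I * (sinh (p - ζ / 2 * I) * rhoC ζ p) := by
  have him : ((ζ : ℂ) / 2 * I).im = ζ / 2 := by simp
  have hζ' : (ζ : ℂ) ≠ 0 := ofReal_ne_zero.2 hζ.ne'
  have hρ := rhoC_eq hζ.ne'
  set p₀ : ℂ := ζ / 2 * I with hp₀
  have hp0 : 0 < p₀.im := by rw [him]; linarith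
  have hp1 : p₀.im < ζ := by rw [him]; linarith
  have hpζ : p.im < ζ := by linarith
  have hne : p ≠ p₀ := fun h => by rw [h, him] at hp; exact lt_irrefl _ hp
  have hcdef : Real.pi / ζ * ζ = Real.pi := by field_simp
  set c := Real.pi / ζ with hc
  have hc0 : 0 < c := by positivity
  have hc' : (c : ℂ) ≠ 0 := ofReal_ne_zero.2 hc0.ne'
  have one_sub : ∀ q : ℂ, HasDerivAt (fun z : ℂ => sinh (z - q)) 1 q := fun q => by
    simpa using hasDerivAt_sinh_sub 1 q
  obtain ⟨G₁, hG₁, hG₁z, -⟩ := exists_differentiableOn_div (F := fun z => sinh (z - p₀))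
    (q := fun z => sinh (c * (z - p₀))) (hstrip_mem_nhds hp0 hp1) (by fun_prop) (by fun_prop)
    (by simp) (fun z hz => sinh_pi_div_eq_zero_iff hp0 hp1 hz) (one_sub p₀)
    (hasDerivAt_sinh_sub c p₀) hc'
  obtain ⟨G₂, hG₂, hG₂z, hG₂p⟩ := exists_differentiableOn_div (F := fun z => sinh (c * (z - p)))
    (q := fun z => sinh (z - p)) (hstrip_mem_nhds h0 hpζ) (by fun_prop) (by fun_prop)
    (by simp) (fun z hz => by
      rw [sinh_eq_zero_iff_of_abs_im_lt, sub_eq_zero]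
      rw [sub_im, abs_lt]
      constructor <;> linarith [hz.1, hz.2]) (hasDerivAt_sinh_sub c p) (one_sub p) one_ne_zero
  have hf : ∀ z, z ≠ p → z ≠ p₀ → sinh (c * (z - p)) ≠ 0 →
      sinh (z - p₀) * (sinh (z - p))⁻¹ * rhoC ζ z
        = G₁ z * G₂ z * (2 * ζ * I)⁻¹ * (sinh (c * (z - p)))⁻¹ := fun z h1 h2 h3 => by
    rw [hρ, hG₁z z h2, hG₂z z h1, div_eq_mul_inv, div_eq_mul_inv]
    have := mul_inv_cancel₀ h3
    linear_combination (-(sinh (z - p₀) * (sinh (c * (z - p₀)))⁻¹ * (sinh (z - p))⁻¹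
      * (2 * ζ * I)⁻¹)) * this
  obtain ⟨-, -, key⟩ := integral_sub_integral_strip (b := ζ) (p := p) (c := c)
    (f := fun z => sinh (z - p₀) * (sinh (z - p))⁻¹ * rhoC ζ z)
    (Ψ := fun z => G₁ z * G₂ z * (2 * ζ * I)⁻¹) h0 hpζ ((hG₁.mul hG₂).mul_const _) hc0
    (fun z hz => hf z (ne_of_im_eq h0 hpζ hz) (ne_of_im_eq hp0 hp1 hz)
      ((sinh_pi_div_eq_zero_iff h0 hpζ (mem_hstrip_of_im_eq hζ.le hz)).not.2
        (ne_of_im_eq h0 hpζ hz)))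
    (by
      filter_upwards [eventually_farReal_re_ne p.re, eventually_farReal_re_ne p₀.re] with z h1 h2
      exact hf z (fun h => h1 (by rw [h])) (fun h => h2 (by rw [h]))
        (sinh_ne_zero_of_re_ne hc0.ne' h1))
    (by
      have := (isBigO_sinh_mul_inv_sinh (-p₀) (-p)).mul (isBigO_rhoC hζ)
      simpa only [one_mul, ← sub_eq_add_neg] using this)
  have h1 : ∀ x : ℝ, sinh (x + ζ * I - p₀) * (sinh (x + ζ * I - p))⁻¹ * rhoC ζ (x + ζ * I)
      = -(sinh (x + p₀) * (sinh (x - p + ζ * I))⁻¹ * rhoC ζ x) := fun x => by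
    have e1 : (x : ℂ) + ζ * I - p₀ = x + p₀ := by rw [hp₀]; ring
    have e2 : (x : ℂ) + ζ * I - p = x - p + ζ * I := by ring
    rw [rhoC_add hζ.ne', mul_neg, e1, e2]
  simp only [h1, integral_neg] at key
  have h2 : 2 * I * ζ * (G₁ p * G₂ p * (2 * ζ * I)⁻¹)
      = 2 * Real.pi * I * (sinh (p - p₀) * rhoC ζ p) := by
    have hcζ : (c : ℂ) * ζ = Real.pi := by rw [← ofReal_mul, hcdef]
    rw [hρ, hG₁z p hne, hG₂p, ← hcζ, div_eq_mul_inv]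
    field_simp
  rw [h2] at key
  linear_combination key

theorem integral_exp_two_mul_inv_cosh_sq {ζ : ℝ} (hζ : 0 < ζ) (hζ2 : ζ < Real.pi / 2) :
    Integrable (fun x : ℝ => cexp (2 * x) * (cosh ((Real.pi / ζ : ℝ) * x) ^ 2)⁻¹) ∧
    ∫ x : ℝ, cexp (2 * x) * (cosh ((Real.pi / ζ : ℝ) * x) ^ 2)⁻¹
      = 2 * ζ ^ 2 / (Real.pi * sin ζ) := by
  have him : ((ζ : ℂ) / 2 * I).im = ζ / 2 := by simp
  have hζ' : (ζ : ℂ) ≠ 0 := ofReal_ne_zero.2 hζ.ne'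
  have hcosh := cosh_pi_div_mul hζ.ne'
  set p : ℂ := ζ / 2 * I with hp
  have hp0 : 0 < p.im := by rw [him]; linarith
  have hp1 : p.im < ζ := by rw [him]; linarith
  have hcdef : Real.pi / ζ * ζ = Real.pi := by field_simp
  have hc2 : 2 < Real.pi / ζ := by rw [lt_div_iff₀ hζ]; linarith
  set c := Real.pi / ζ with hc
  have hc0 : 0 < c := by linarith
  have hc' : (c : ℂ) ≠ 0 := ofReal_ne_zero.2 hc0.ne'
  have hcζ : (c : ℂ) * ζ = Real.pi := by rw [← ofReal_mul, hcdef]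
  have hexp : HasDerivAt (fun z : ℂ => cexp (2 * z) - cexp (2 * p)) (cexp (2 * p) * 2) p := by
    have h1 : HasDerivAt (fun z : ℂ => 2 * z) 2 p := by
      simpa using (hasDerivAt_id p).const_mul (2 : ℂ)
    exact h1.cexp.sub_const _
  obtain ⟨G, hG, hGz, hGp⟩ := exists_differentiableOn_div
    (F := fun z => cexp (2 * z) - cexp (2 * p)) (q := fun z => sinh (c * (z - p)))
    (hstrip_mem_nhds hp0 hp1) (by fun_prop) (by fun_prop)
    (by simp) (fun z hz => sinh_pi_div_eq_zero_iff hp0 hp1 hz) hexp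
    (hasDerivAt_sinh_sub c p) hc'
  have hoexp : (fun z : ℂ => cexp (2 * z) - cexp (2 * p)) =O[farReal]
      fun z => Real.exp (2 * |z.re|) := by
    refine IsBigO.sub ?_ ?_
    · refine IsBigO.of_bound 1 (Eventually.of_forall fun z => ?_)
      rw [norm_exp, Real.norm_eq_abs, Real.abs_exp, one_mul]
      refine Real.exp_le_exp.2 ?_
      simp [le_abs_self]
    · refine IsBigO.of_bound ‖cexp (2 * p)‖ (Eventually.of_forall fun z => ?_)
      rw [Real.norm_eq_abs, Real.abs_exp]
      refine le_mul_of_one_le_right (norm_nonneg _) (Real.one_le_exp (by positivity))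
  obtain ⟨i0, ib, key⟩ := integral_sub_integral_strip (b := ζ) (p := p) (c := 2 * c - 2)
    (f := fun z => (cexp (2 * z) - cexp (2 * p)) * (sinh (c * (z - p)))⁻¹ *
      (sinh (c * (z - p)))⁻¹) (Ψ := G) hp0 hp1 hG (by linarith)
    (fun z hz => by rw [hGz z (ne_of_im_eq hp0 hp1 hz), div_eq_mul_inv])
    (by
      filter_upwards [eventually_farReal_re_ne p.re] with z h1
      rw [hGz z (fun h => h1 (by rw [h])), div_eq_mul_inv])
    (by
      have h1 := isBigO_inv_sinh_sub hc0.ne' p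
      refine ((hoexp.mul h1).mul h1).congr_right fun z => ?_
      rw [← Real.exp_add, ← Real.exp_add, abs_of_pos hc0]
      ring_nf)
  have hsq : ∀ z : ℂ, (sinh (c * (z - p)))⁻¹ * (sinh (c * (z - p)))⁻¹
      = -(cosh (c * z) ^ 2)⁻¹ := fun z => by
    rw [hcosh, mul_pow, I_sq, neg_one_mul, inv_neg, neg_neg, ← mul_inv, pow_two]
  have hcadd : ∀ x : ℝ, cosh (c * (x + ζ * I)) ^ 2 = cosh (c * x) ^ 2 := fun x => by
    have : (c : ℂ) * (x + ζ * I) = c * x + Real.pi * I := by rw [← hcζ]; ring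
    rw [this, cosh_add, cosh_mul_I, sinh_mul_I, cos_pi, sin_pi]
    ring
  have hdiff : ∀ x : ℝ, (cexp (2 * x) - cexp (2 * p)) * (sinh (c * (x - p)))⁻¹ *
      (sinh (c * (x - p)))⁻¹ - (cexp (2 * (x + ζ * I)) - cexp (2 * p)) *
      (sinh (c * (x + ζ * I - p)))⁻¹ * (sinh (c * (x + ζ * I - p)))⁻¹
      = (cexp (2 * ζ * I) - 1) * (cexp (2 * x) * (cosh (c * x) ^ 2)⁻¹) := fun x => by
    have : cexp (2 * (x + ζ * I)) = cexp (2 * x) * cexp (2 * ζ * I) := by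
      rw [← Complex.exp_add]; ring_nf
    rw [mul_assoc, mul_assoc, hsq, hsq, hcadd, this]
    ring
  have hsin : sin (ζ : ℂ) ≠ 0 := by
    rw [← ofReal_sin]
    exact ofReal_ne_zero.2 (Real.sin_pos_of_pos_of_lt_pi hζ (by linarith)).ne'
  have hexp2 : cexp (2 * ζ * I) - 1 = 2 * I * sin ζ * cexp (ζ * I) := by
    have h1 : cexp (2 * ζ * I) = cexp (ζ * I) * cexp (ζ * I) := by
      rw [← Complex.exp_add]; ring_nf
    have h2 : cexp (-ζ * I) * cexp (ζ * I) = 1 := by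
      rw [← Complex.exp_add]; simp
    rw [h1, sin]
    linear_combination h2 +
      (cexp (ζ * I) * cexp (ζ * I) - cexp (-ζ * I) * cexp (ζ * I)) * I_mul_I
  have hne : cexp (2 * ζ * I) - 1 ≠ 0 := by
    rw [hexp2]
    exact mul_ne_zero (mul_ne_zero (mul_ne_zero two_ne_zero I_ne_zero) hsin) (exp_ne_zero _)
  rw [← integral_sub i0 ib] at key
  have hint := i0.sub ib
  simp only [hdiff] at key
  have hint' : Integrable fun x : ℝ => (cexp (2 * ζ * I) - 1) *
      (cexp (2 * x) * (cosh (c * x) ^ 2)⁻¹) := hint.congr (Eventually.of_forall hdiff)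
  refine ⟨(integrable_const_mul_iff (isUnit_iff_ne_zero.2 hne) _).1 hint', ?_⟩
  rw [integral_const_mul, hGp] at key
  refine mul_left_cancel₀ hne (key.trans ?_)
  have h2p : 2 * p = ζ * I := by rw [hp]; ring
  rw [hexp2, h2p, ← hcζ]
  field_simp
end

section
open Complex Asymptotics Topology

theorem rho_nonneg {ζ : ℝ} (hζ : 0 < ζ) (x : ℝ) : 0 ≤ rho ζ x := by
  have := Real.cosh_pos (Real.pi * x / ζ)
  rw [rho]; positivity

theorem norm_rhoC_ofReal {ζ : ℝ} (hζ : 0 < ζ) (x : ℝ) : ‖rhoC ζ x‖ = rho ζ x := by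
  rw [← ofReal_rho, norm_real, Real.norm_of_nonneg (rho_nonneg hζ x)]

/-- The common dominating weight. -/
noncomputable def weight (ζ x : ℝ) : ℝ := Real.cosh x ^ 2 * rho ζ x

theorem integrable_weight {ζ : ℝ} (hζ : 0 < ζ) (hζ2 : ζ < Real.pi / 2) :
    Integrable (weight ζ) := by
  have hc2 : 2 < Real.pi / ζ := by rw [lt_div_iff₀ hζ]; linarith
  have hcont : ContinuousOn (fun z : ℂ => cosh z ^ 2 * rhoC ζ z) {z | z.im = 0} := by
    refine ContinuousOn.mul (by fun_prop) ?_
    unfold rhoC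
    refine ContinuousOn.inv₀ (by fun_prop) fun z hz => ?_
    have : z = (z.re : ℂ) := Complex.ext rfl (by simpa using hz)
    rw [this, ← ofReal_mul, ← ofReal_cosh]
    have h1 := (Real.cosh_pos (Real.pi / ζ * z.re)).ne'
    exact_mod_cast mul_ne_zero (mul_ne_zero two_ne_zero hζ.ne') h1
  have hcosh : (fun z : ℂ => cosh z) =O[farReal] fun z => Real.exp |z.re| := by
    refine IsBigO.of_norm_left ?_
    simpa only [norm_cosh_eq] using (isBigO_sinh_add (Real.pi / 2 * I)).norm_left
  have ho : (fun z : ℂ => cosh z ^ 2 * rhoC ζ z) =O[farReal]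
      fun z => Real.exp (-(Real.pi / ζ - 2) * |z.re|) :=
    ((hcosh.pow 2).mul (isBigO_rhoC hζ)).congr_right fun z => by
      rw [← Real.exp_nat_mul, ← Real.exp_add]
      push_cast
      ring_nf
  have h := (integrable_line hcont (a := 0) (by simp) (by linarith) ho).norm
  refine h.congr (Eventually.of_forall fun x => ?_)
  simp only [ofReal_zero, zero_mul, add_zero, norm_mul, norm_pow, norm_rhoC_ofReal hζ, weight]
  rw [← ofReal_cosh, norm_real, Real.norm_eq_abs, sq_abs]

theorem cosh_mul_rho_le_weight {ζ : ℝ} (hζ : 0 < ζ) (x : ℝ) :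
    Real.cosh x * rho ζ x ≤ weight ζ x := by
  refine mul_le_mul_of_nonneg_right ?_ (rho_nonneg hζ x)
  nlinarith [Real.one_le_cosh x]

theorem weight_nonneg {ζ : ℝ} (hζ : 0 < ζ) (x : ℝ) : 0 ≤ weight ζ x :=
  mul_nonneg (sq_nonneg _) (rho_nonneg hζ x)

theorem norm_sinh_add_mul_I_le (x α : ℝ) : ‖sinh (x + α * I)‖ ≤ Real.cosh x := by
  simpa using norm_sinh_le_cosh_re_s2 (x + α * I)

theorem norm_inv_sinh_le_s2 {s : ℝ} (hs : 0 < s) {x θ : ℝ} (hθ : s ≤ Real.sin θ) :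
    ‖(sinh (x + θ * I))⁻¹‖ ≤ s⁻¹ := by
  rw [norm_inv]
  refine inv_anti₀ hs ?_
  have := abs_sin_im_le_norm_sinh_s2 (x + θ * I)
  simp only [add_im, ofReal_im, mul_im, ofReal_re, I_im, I_re, mul_one, mul_zero, add_zero,
    zero_add] at this
  exact hθ.trans ((le_abs_self _).trans this)

/-- The integrand of the double integrals. -/
noncomputable def pairKernel (ζ α β θ : ℝ) (x : ℝ × ℝ) : ℂ :=
  sinh (x.1 + α * I) * sinh (x.2 + β * I) * (sinh ((x.2 - x.1 : ℝ) + θ * I))⁻¹ *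
    rhoC ζ x.1 * rhoC ζ x.2

theorem measurable_pairKernel (ζ α β θ : ℝ) : Measurable (pairKernel ζ α β θ) := by
  unfold pairKernel rhoC
  fun_prop

theorem norm_pairKernel_le {ζ : ℝ} (hζ : 0 < ζ) (α β : ℝ) {s θ : ℝ} (hs : 0 < s)
    (hθ : s ≤ Real.sin θ) (x : ℝ × ℝ) :
    ‖pairKernel ζ α β θ x‖ ≤ s⁻¹ * (weight ζ x.1 * weight ζ x.2) := by
  have h1 := norm_sinh_add_mul_I_le x.1 α
  have h2 := norm_sinh_add_mul_I_le x.2 β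
  have h3 := norm_inv_sinh_le_s2 hs (x := x.2 - x.1) hθ
  have h4 := cosh_mul_rho_le_weight hζ x.1
  have h5 := cosh_mul_rho_le_weight hζ x.2
  have h6 := weight_nonneg hζ x.1
  have r1 := rho_nonneg hζ x.1
  have r2 := rho_nonneg hζ x.2
  have c1 := Real.cosh_pos x.1
  have c2 := Real.cosh_pos x.2
  have hs' := inv_pos.2 hs
  rw [pairKernel, norm_mul, norm_mul, norm_mul, norm_mul, norm_rhoC_ofReal hζ, norm_rhoC_ofReal hζ]
  calc _ ≤ Real.cosh x.1 * Real.cosh x.2 * s⁻¹ * rho ζ x.1 * rho ζ x.2 := by gcongr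
    _ = s⁻¹ * ((Real.cosh x.1 * rho ζ x.1) * (Real.cosh x.2 * rho ζ x.2)) := by ring
    _ ≤ _ := by gcongr

theorem integrable_weight_prod {ζ : ℝ} (hζ : 0 < ζ) (hζ2 : ζ < Real.pi / 2) (s : ℝ) :
    Integrable (fun x : ℝ × ℝ => s⁻¹ * (weight ζ x.1 * weight ζ x.2)) :=
  ((integrable_weight hζ hζ2).mul_prod (integrable_weight hζ hζ2)).const_mul _

theorem integrable_pairKernel {ζ : ℝ} (hζ : 0 < ζ) (hζ2 : ζ < Real.pi / 2) (α β : ℝ) {θ : ℝ}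
    (hθ : 0 < Real.sin θ) : Integrable (pairKernel ζ α β θ) :=
  (integrable_weight_prod hζ hζ2 (Real.sin θ)).mono'
    (measurable_pairKernel ζ α β θ).aestronglyMeasurable
    (Eventually.of_forall (norm_pairKernel_le hζ α β hθ le_rfl))

theorem eventually_half_sin_le {θ₀ : ℝ} (h : 0 < Real.sin θ₀) :
    ∀ᶠ θ in 𝓝 θ₀, Real.sin θ₀ / 2 ≤ Real.sin θ :=
  (Real.continuous_sin.tendsto θ₀).eventually_const_le (by linarith)

theorem continuousAt_inv_sinh {θ₀ : ℝ} (h : 0 < Real.sin θ₀) (x : ℝ) :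
    ContinuousAt (fun θ : ℝ => (sinh (x + θ * I))⁻¹) θ₀ := by
  refine ContinuousAt.inv₀ (by fun_prop) (sinh_ne_zero_of_sin_im_ne ?_)
  simpa using h.ne'

theorem continuousAt_integral_pairKernel {ζ : ℝ} (hζ : 0 < ζ) (hζ2 : ζ < Real.pi / 2) (α β : ℝ)
    {θ₀ : ℝ} (hθ : 0 < Real.sin θ₀) :
    ContinuousAt (fun θ => ∫ x, pairKernel ζ α β θ x) θ₀ := by
  refine continuousAt_of_dominated
    (bound := fun x => (Real.sin θ₀ / 2)⁻¹ * (weight ζ x.1 * weight ζ x.2))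
    (Eventually.of_forall fun θ => (measurable_pairKernel ζ α β θ).aestronglyMeasurable) ?_
    (integrable_weight_prod hζ hζ2 _) (Eventually.of_forall fun x => ?_)
  · filter_upwards [eventually_half_sin_le hθ] with θ h
    exact Eventually.of_forall (norm_pairKernel_le hζ α β (half_pos hθ) h)
  · unfold pairKernel
    have := continuousAt_inv_sinh hθ (x.2 - x.1)
    fun_prop

/-- The integrand of the single integral left by the pole of `rhoC`. -/
noncomputable def ratioKernel (ζ β θ x : ℝ) : ℂ :=
  sinh (x + β * I) * (sinh (x + θ * I))⁻¹ * rhoC ζ x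

theorem measurable_ratioKernel (ζ β θ : ℝ) : Measurable (ratioKernel ζ β θ) := by
  unfold ratioKernel rhoC
  fun_prop

theorem norm_ratioKernel_le {ζ : ℝ} (hζ : 0 < ζ) (β : ℝ) {s θ : ℝ} (hs : 0 < s)
    (hθ : s ≤ Real.sin θ) (x : ℝ) : ‖ratioKernel ζ β θ x‖ ≤ s⁻¹ * weight ζ x := by
  have h2 := norm_sinh_add_mul_I_le x β
  have h3 := norm_inv_sinh_le_s2 hs (x := x) hθ
  have h5 := cosh_mul_rho_le_weight hζ x
  have r2 := rho_nonneg hζ x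
  have c2 := Real.cosh_pos x
  have hs' := inv_pos.2 hs
  rw [ratioKernel, norm_mul, norm_mul, norm_rhoC_ofReal hζ]
  calc _ ≤ Real.cosh x * s⁻¹ * rho ζ x := by gcongr
    _ = s⁻¹ * (Real.cosh x * rho ζ x) := by ring
    _ ≤ _ := by gcongr

theorem integrable_ratioKernel {ζ : ℝ} (hζ : 0 < ζ) (hζ2 : ζ < Real.pi / 2) (β : ℝ) {θ : ℝ}
    (hθ : 0 < Real.sin θ) : Integrable (ratioKernel ζ β θ) :=
  ((integrable_weight hζ hζ2).const_mul (Real.sin θ)⁻¹).mono'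
    (measurable_ratioKernel ζ β θ).aestronglyMeasurable
    (Eventually.of_forall (norm_ratioKernel_le hζ β hθ le_rfl))

theorem continuousAt_integral_ratioKernel {ζ : ℝ} (hζ : 0 < ζ) (hζ2 : ζ < Real.pi / 2) (β : ℝ)
    {θ₀ : ℝ} (hθ : 0 < Real.sin θ₀) :
    ContinuousAt (fun θ => ∫ x, ratioKernel ζ β θ x) θ₀ := by
  refine continuousAt_of_dominated (bound := fun x => (Real.sin θ₀ / 2)⁻¹ * weight ζ x)
    (Eventually.of_forall fun θ => (measurable_ratioKernel ζ β θ).aestronglyMeasurable) ?_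
    ((integrable_weight hζ hζ2).const_mul _) (Eventually.of_forall fun x => ?_)
  · filter_upwards [eventually_half_sin_le hθ] with θ h
    exact Eventually.of_forall (norm_ratioKernel_le hζ β (half_pos hθ) h)
  · unfold ratioKernel
    have := continuousAt_inv_sinh hθ x
    fun_prop

/-- The integrand of the single integral left by the pole of the kernel. -/
noncomputable def diagKernel (ζ α β ε x : ℝ) : ℂ :=
  sinh (x + α * I) * sinh (x + (ε + β : ℝ) * I) * rhoC ζ x * rhoC ζ (x + ε * I)

theorem measurable_diagKernel (ζ α β ε : ℝ) : Measurable (diagKernel ζ α β ε) := by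
  unfold diagKernel rhoC
  fun_prop

theorem abs_cos_im_le_norm_cosh (w : ℂ) : |Real.cos w.im| ≤ ‖cosh w‖ := by
  have h := abs_sin_im_le_norm_sinh_s2 (w + Real.pi / 2 * I)
  have him : (w + Real.pi / 2 * I).im = w.im + Real.pi / 2 := by simp
  rwa [him, Real.sin_add_pi_div_two, ← norm_cosh_eq] at h

theorem norm_diagKernel_le {ζ : ℝ} (hζ : 0 < ζ) (α β : ℝ) {ε : ℝ}
    (hε : 1 / 2 ≤ Real.cos (Real.pi / ζ * ε)) (x : ℝ) :
    ‖diagKernel ζ α β ε x‖ ≤ ζ⁻¹ * weight ζ x := by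
  have h1 := norm_sinh_add_mul_I_le x α
  have h2 := norm_sinh_add_mul_I_le x (ε + β)
  have r := rho_nonneg hζ x
  have c := Real.cosh_pos x
  have h3 : ‖rhoC ζ (x + ε * I)‖ ≤ ζ⁻¹ := by
    rw [rhoC, norm_inv]
    refine inv_anti₀ hζ ?_
    have h := abs_cos_im_le_norm_cosh ((Real.pi / ζ : ℝ) * (x + ε * I))
    have him : ((Real.pi / ζ : ℝ) * ((x : ℂ) + ε * I)).im = Real.pi / ζ * ε := by
      rw [im_ofReal_mul]; simp
    rw [him] at h
    have h' := hε.trans ((le_abs_self _).trans h)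
    rw [norm_mul, norm_mul, norm_real, Real.norm_of_nonneg hζ.le, Complex.norm_ofNat]
    nlinarith
  rw [diagKernel, norm_mul, norm_mul, norm_mul, norm_rhoC_ofReal hζ]
  calc _ ≤ Real.cosh x * Real.cosh x * rho ζ x * ζ⁻¹ := by gcongr
    _ = _ := by rw [weight]; ring

theorem eventually_half_le_cos (c : ℝ) : ∀ᶠ ε : ℝ in 𝓝 0, 1 / 2 ≤ Real.cos (c * ε) := by
  have h : Continuous fun ε : ℝ => Real.cos (c * ε) := by fun_prop
  refine (h.tendsto 0).eventually_const_le ?_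
  norm_num

theorem integrable_diagKernel {ζ : ℝ} (hζ : 0 < ζ) (hζ2 : ζ < Real.pi / 2) (α β : ℝ) {ε : ℝ}
    (hε : 1 / 2 ≤ Real.cos (Real.pi / ζ * ε)) : Integrable (diagKernel ζ α β ε) :=
  ((integrable_weight hζ hζ2).const_mul ζ⁻¹).mono'
    (measurable_diagKernel ζ α β ε).aestronglyMeasurable
    (Eventually.of_forall (norm_diagKernel_le hζ α β hε))

theorem continuousAt_integral_diagKernel {ζ : ℝ} (hζ : 0 < ζ) (hζ2 : ζ < Real.pi / 2) (α β : ℝ) :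
    ContinuousAt (fun ε => ∫ x, diagKernel ζ α β ε x) 0 := by
  refine continuousAt_of_dominated (bound := fun x => ζ⁻¹ * weight ζ x)
    (Eventually.of_forall fun ε => (measurable_diagKernel ζ α β ε).aestronglyMeasurable) ?_
    ((integrable_weight hζ hζ2).const_mul _) (Eventually.of_forall fun x => ?_)
  · filter_upwards [eventually_half_le_cos (Real.pi / ζ)] with ε h
    exact Eventually.of_forall (norm_diagKernel_le hζ α β h)
  · have h : ContinuousAt (fun ε : ℝ => rhoC ζ (x + ε * I)) 0 := by
      unfold rhoC
      refine ContinuousAt.inv₀ (by fun_prop) ?_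
      have h1 := (Real.cosh_pos (Real.pi / ζ * x)).ne'
      rw [ofReal_zero, zero_mul, add_zero, ← ofReal_mul, ← ofReal_cosh]
      exact_mod_cast mul_ne_zero (mul_ne_zero two_ne_zero hζ.ne') h1
    unfold diagKernel
    fun_prop

/-- The limiting diagonal integral in closed form. -/
theorem integral_diagKernel_zero {ζ : ℝ} (hζ : 0 < ζ) (hζ2 : ζ < Real.pi / 2) :
    ∫ x, diagKernel ζ (-(3 * ζ / 2)) (-(ζ / 2)) 0 x
      = cos (2 * ζ) / (4 * Real.pi * sin ζ) - cos ζ / (4 * Real.pi * ζ) := by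
  have hc0 : 0 < Real.pi / ζ := by positivity
  obtain ⟨i1, e1⟩ := integral_inv_cosh_sq hc0
  obtain ⟨i2, e2⟩ := integral_exp_two_mul_inv_cosh_sq hζ hζ2
  have i3 := i2.comp_neg
  have e3 := integral_neg_eq_self
    (fun x : ℝ => cexp (2 * x) * (cosh ((Real.pi / ζ : ℝ) * x) ^ 2)⁻¹) volume
  rw [e2] at e3
  have hζ' : (ζ : ℂ) ≠ 0 := ofReal_ne_zero.2 hζ.ne'
  have hπ : (Real.pi : ℂ) ≠ 0 := ofReal_ne_zero.2 Real.pi_ne_zero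
  have hsin : sin (ζ : ℂ) ≠ 0 := by
    rw [← ofReal_sin]
    exact ofReal_ne_zero.2 (Real.sin_pos_of_pos_of_lt_pi hζ (by linarith)).ne'
  have hx : ∀ x : ℝ, diagKernel ζ (-(3 * ζ / 2)) (-(ζ / 2)) 0 x
      = cexp (-(2 * ζ * I)) / (16 * ζ ^ 2) * (cexp (2 * x) * (cosh ((Real.pi / ζ : ℝ) * x) ^ 2)⁻¹)
      + cexp (2 * ζ * I) / (16 * ζ ^ 2) *
        (cexp (2 * (-x : ℝ)) * (cosh ((Real.pi / ζ : ℝ) * (-x : ℝ)) ^ 2)⁻¹)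
      + (-(cos ζ / (8 * ζ ^ 2))) * (cosh ((Real.pi / ζ : ℝ) * x) ^ 2)⁻¹ := by
    intro x
    have hneg : cosh ((Real.pi / ζ : ℝ) * ((-x : ℝ) : ℂ)) = cosh ((Real.pi / ζ : ℝ) * x) := by
      rw [ofReal_neg, mul_neg, cosh_neg]
    have hsinh : sinh (x + (-(3 * ζ / 2) : ℝ) * I) * sinh (x + (0 + -(ζ / 2) : ℝ) * I)
        = (cexp (-(2 * ζ * I)) * cexp (2 * x) + cexp (2 * ζ * I) * cexp (2 * (-x : ℝ))) / 4
          - cos ζ / 2 := by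
      rw [sinh, sinh, cos]
      have : ∀ a b c d : ℂ, (a - b) / 2 * ((c - d) / 2)
        = (a * c + b * d) / 4 - (a * d + b * c) / 4 := fun a b c d => by ring
      rw [this]
      simp only [← Complex.exp_add]
      push_cast
      ring_nf
    rw [hneg, diagKernel, hsinh, ofReal_zero, zero_mul, add_zero, rhoC, mul_inv, mul_inv]
    field_simp
    ring
  simp only [hx]
  rw [integral_add (by exact (i2.const_mul _).add (i3.const_mul _)) (i1.const_mul _),
    integral_add (i2.const_mul _) (i3.const_mul _), integral_const_mul, integral_const_mul,
    integral_const_mul, e1, e2, e3]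
  have h2 : cexp (-(2 * ζ * I)) = 2 * cos (2 * ζ) - cexp (2 * ζ * I) := by
    rw [cos, neg_mul]; ring
  rw [h2]
  push_cast
  field_simp
  ring
end

section
open Complex Asymptotics Topology

theorem tendsto_line_const_add (θ₀ s : ℝ) :
    Tendsto (fun ε : ℝ => θ₀ + s * ε) (𝓝[>] 0) (𝓝 θ₀) := by
  have h : Continuous fun ε : ℝ => θ₀ + s * ε := by fun_prop
  simpa using (h.tendsto 0).mono_left nhdsWithin_le_nhds

theorem first_integral_eq {ζ ε : ℝ} (hζ : 0 < ζ) (hζ2 : ζ < Real.pi / 2) (h0 : 0 < ε)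
    (hε : ε < ζ / 2) (hcos : 1 / 2 ≤ Real.cos (Real.pi / ζ * ε)) :
    ∫ x₁ : ℝ, ∫ x₂ : ℝ, pairKernel ζ (-(3 * ζ / 2)) (-(ζ / 2)) (-ε) (x₁, x₂)
      = -(∫ x, pairKernel ζ (-(3 * ζ / 2)) (ζ / 2) (ζ - ε) x)
        + 2 * Real.pi * I * ∫ x, diagKernel ζ (-(3 * ζ / 2)) (-(ζ / 2)) ε x := by
  have hsin : 0 < Real.sin (ζ - ε) := Real.sin_pos_of_pos_of_lt_pi (by linarith) (by linarith)
  have hK := integrable_pairKernel hζ hζ2 (-(3 * ζ / 2)) (ζ / 2) hsin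
  have hM := integrable_diagKernel hζ hζ2 (-(3 * ζ / 2)) (-(ζ / 2)) hcos
  have inner : ∀ x₁ : ℝ, ∫ x₂ : ℝ, pairKernel ζ (-(3 * ζ / 2)) (-(ζ / 2)) (-ε) (x₁, x₂)
      = -(∫ x₂ : ℝ, pairKernel ζ (-(3 * ζ / 2)) (ζ / 2) (ζ - ε) (x₁, x₂))
        + 2 * Real.pi * I * diagKernel ζ (-(3 * ζ / 2)) (-(ζ / 2)) ε x₁ := by
    intro x₁
    have him : ((x₁ : ℂ) + ε * I).im = ε := by simp
    have key := integral_kernel_shift hζ (by linarith) (p := x₁ + ε * I)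
      (by rw [him]; exact h0) (by rw [him]; exact hε)
    set A := sinh (x₁ + (-(3 * ζ / 2) : ℝ) * I) * rhoC ζ x₁ with hA
    have e1 : ∀ x₂ : ℝ, pairKernel ζ (-(3 * ζ / 2)) (-(ζ / 2)) (-ε) (x₁, x₂)
        = A * (sinh (x₂ - ζ / 2 * I) * (sinh (x₂ - (x₁ + ε * I)))⁻¹ * rhoC ζ x₂) := by
      intro x₂
      have a1 : (x₂ : ℂ) + (-(ζ / 2) : ℝ) * I = x₂ - ζ / 2 * I := by push_cast; ring
      have a2 : ((x₂ - x₁ : ℝ) : ℂ) + (-ε : ℝ) * I = x₂ - (x₁ + ε * I) := by push_cast; ring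
      simp only [pairKernel]
      rw [a1, a2, hA]
      ring
    have e2 : ∀ x₂ : ℝ, pairKernel ζ (-(3 * ζ / 2)) (ζ / 2) (ζ - ε) (x₁, x₂)
        = A * (sinh (x₂ + ζ / 2 * I) * (sinh (x₂ - (x₁ + ε * I) + ζ * I))⁻¹ * rhoC ζ x₂) := by
      intro x₂
      have a1 : (x₂ : ℂ) + (ζ / 2 : ℝ) * I = x₂ + ζ / 2 * I := by push_cast; ring
      have a2 : ((x₂ - x₁ : ℝ) : ℂ) + (ζ - ε : ℝ) * I = x₂ - (x₁ + ε * I) + ζ * I := by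
        push_cast; ring
      simp only [pairKernel]
      rw [a1, a2, hA]
      ring
    have a3 : (x₁ : ℂ) + ε * I - ζ / 2 * I = x₁ + (ε + -(ζ / 2) : ℝ) * I := by push_cast; ring
    simp only [e1, e2, integral_const_mul, key, diagKernel]
    rw [a3, hA]
    ring
  simp only [inner]
  rw [integral_add (by exact hK.integral_prod_left.neg) (hM.const_mul _), integral_neg,
    integral_const_mul,
    Measure.volume_eq_prod, integral_prod _ hK]

theorem second_integral_eq {ζ ε : ℝ} (hζ : 0 < ζ) (hζ2 : ζ < Real.pi / 2) (h0 : 0 < ε)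
    (hε : ε < Real.pi - 2 * ζ) :
    ∫ x₁ : ℝ, ∫ x₂ : ℝ, pairKernel ζ (-(5 * ζ / 2)) (ζ / 2) (2 * ζ + ε) (x₁, x₂)
      = -(∫ x, pairKernel ζ (-(3 * ζ / 2)) (ζ / 2) (ζ + ε) x)
        - 2 * cos ζ * sinh (ζ * I) * ∫ x, ratioKernel ζ (ζ / 2) (3 * ζ / 2 + ε) x := by
  have hsin1 : 0 < Real.sin (2 * ζ + ε) :=
    Real.sin_pos_of_pos_of_lt_pi (by linarith) (by linarith)
  have hsin2 : 0 < Real.sin (ζ + ε) := Real.sin_pos_of_pos_of_lt_pi (by linarith) (by linarith)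
  have hsin3 : 0 < Real.sin (3 * ζ / 2 + ε) :=
    Real.sin_pos_of_pos_of_lt_pi (by linarith) (by linarith)
  have hK1 := integrable_pairKernel hζ hζ2 (-(5 * ζ / 2)) (ζ / 2) hsin1
  have hK2 := integrable_pairKernel hζ hζ2 (-(3 * ζ / 2)) (ζ / 2) hsin2
  have hJ := integrable_ratioKernel hζ hζ2 (ζ / 2) hsin3
  have inner : ∀ x₂ : ℝ, ∫ x₁ : ℝ, pairKernel ζ (-(5 * ζ / 2)) (ζ / 2) (2 * ζ + ε) (x₁, x₂)
      = -(∫ x₁ : ℝ, pairKernel ζ (-(3 * ζ / 2)) (ζ / 2) (ζ + ε) (x₁, x₂))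
        + -(2 * cos ζ * sinh (ζ * I)) * ratioKernel ζ (ζ / 2) (3 * ζ / 2 + ε) x₂ := by
    intro x₂
    set g : ℂ → ℂ := fun z => sinh (z + (-(5 * ζ / 2) : ℝ) * I) *
      (sinh (x₂ - z + (2 * ζ + ε : ℝ) * I))⁻¹ with hg
    have hgd : DifferentiableOn ℂ g (hstrip ζ) := by
      refine DifferentiableOn.mul (by fun_prop) (DifferentiableOn.inv (by fun_prop) ?_)
      intro z hz
      refine sinh_ne_zero_of_sin_im_ne ?_
      have : ((x₂ : ℂ) - z + (2 * ζ + ε : ℝ) * I).im = 2 * ζ + ε - z.im := by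
        simp; ring
      rw [this]
      exact (Real.sin_pos_of_pos_of_lt_pi (by linarith [hz.2]) (by linarith [hz.1])).ne'
    have hgo : g =O[farReal] fun _ => (1 : ℝ) := by
      refine (isBigO_sinh_mul_inv_sinh ((-(5 * ζ / 2) : ℝ) * I)
        (-(x₂ + (2 * ζ + ε : ℝ) * I))).neg_left.congr_left fun z => ?_
      have : z + -(x₂ + (2 * ζ + ε : ℝ) * I) = -(x₂ - z + (2 * ζ + ε : ℝ) * I) := by ring
      rw [this, sinh_neg, inv_neg]
      simp only [hg]
      ring
    have key := integral_mul_rhoC_shift hζ hgd hgo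
    set A := sinh (x₂ + (ζ / 2 : ℝ) * I) * rhoC ζ x₂ with hA
    have e1 : ∀ x₁ : ℝ, pairKernel ζ (-(5 * ζ / 2)) (ζ / 2) (2 * ζ + ε) (x₁, x₂)
        = A * (g x₁ * rhoC ζ x₁) := by
      intro x₁
      simp only [pairKernel, hg, hA, ofReal_sub]
      ring
    have e2 : ∀ x₁ : ℝ, pairKernel ζ (-(3 * ζ / 2)) (ζ / 2) (ζ + ε) (x₁, x₂)
        = A * (g (x₁ + ζ * I) * rhoC ζ x₁) := by
      intro x₁
      have a1 : (x₁ : ℂ) + ζ * I + (-(5 * ζ / 2) : ℝ) * I = x₁ + (-(3 * ζ / 2) : ℝ) * I := by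
        push_cast; ring
      have a2 : (x₂ : ℂ) - (x₁ + ζ * I) + (2 * ζ + ε : ℝ) * I
          = (x₂ - x₁ : ℝ) + (ζ + ε : ℝ) * I := by push_cast; ring
      simp only [pairKernel, hg, hA]
      rw [a1, a2]
      ring
    have e3 : g (ζ / 2 * I) = -(2 * cos ζ * sinh (ζ * I)) *
        (sinh (x₂ + (3 * ζ / 2 + ε : ℝ) * I))⁻¹ := by
      have a1 : (ζ : ℂ) / 2 * I + (-(5 * ζ / 2) : ℝ) * I = -(2 * (ζ * I)) := by push_cast; ring
      have a2 : (x₂ : ℂ) - ζ / 2 * I + (2 * ζ + ε : ℝ) * I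
          = x₂ + (3 * ζ / 2 + ε : ℝ) * I := by push_cast; ring
      simp only [hg]
      rw [a1, a2, sinh_neg, sinh_two_mul, cosh_mul_I]
      ring
    simp only [e1, e2, integral_const_mul, key, ratioKernel]
    rw [e3, hA]
    ring
  rw [integral_integral_swap (f := fun x₁ x₂ : ℝ =>
    pairKernel ζ (-(5 * ζ / 2)) (ζ / 2) (2 * ζ + ε) (x₁, x₂)) (by exact hK1)]
  simp only [inner]
  rw [integral_add (by exact hK2.integral_prod_right.neg) (hJ.const_mul _), integral_neg,
    integral_const_mul, Measure.volume_eq_prod, integral_prod_symm _ hK2]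
  ring

end

/-- One-point function ⟨E^{0,0}⟩ of the integrable spin-1 XXZ chain:
explicit evaluation of the multiple-integral representation. -/
theorem stmt2 (ζ : ℝ) (hζ0 : 0 < ζ) (hζ1 : ζ < Real.pi / 2)
    (η : ℂ) (hη : η = Complex.I * ζ)
    (I₁ I₂ : ℝ → ℂ)
    (hI₁ : ∀ ε : ℝ, I₁ ε =
      ∫ x₁ : ℝ, ∫ x₂ : ℝ,
        Complex.sinh ((x₁ : ℂ) - 3 * η / 2) * Complex.sinh ((x₂ : ℂ) - η / 2) /
          (Complex.sinh η * Complex.sinh ((x₂ : ℂ) - (x₁ : ℂ) - Complex.I * (ε : ℂ))) *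
          (rho ζ x₁ : ℂ) * (rho ζ x₂ : ℂ))
    (hI₂ : ∀ ε : ℝ, I₂ ε =
      ∫ x₁ : ℝ, ∫ x₂ : ℝ,
        Complex.sinh ((x₁ : ℂ) - 5 * η / 2) * Complex.sinh ((x₂ : ℂ) + η / 2) /
          (Complex.sinh η * Complex.sinh ((x₂ : ℂ) - (x₁ : ℂ) + 2 * η + Complex.I * (ε : ℂ))) *
          (rho ζ x₁ : ℂ) * (rho ζ x₂ : ℂ)) :
    ∃ L : ℂ,
      Tendsto (fun ε : ℝ => I₁ ε - I₂ ε) (nhdsWithin 0 (Set.Ioi 0)) (nhds L) ∧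
      L + 1 - 2 * (Real.cos ζ : ℂ) *
          (∫ x : ℝ, (rho ζ x : ℂ) *
            (Complex.sinh ((x : ℂ) + η / 2) / Complex.sinh ((x : ℂ) + 3 * η / 2)))
        = (((ζ - Real.sin ζ * Real.cos ζ) / (2 * ζ * Real.sin ζ ^ 2) : ℝ) : ℂ) := by
  open Complex Topology in
  have hη' : η = ζ * I := by rw [hη, mul_comm]
  have hsin : 0 < Real.sin ζ := Real.sin_pos_of_pos_of_lt_pi hζ0 (by linarith)
  have hsin3 : 0 < Real.sin (3 * ζ / 2) := Real.sin_pos_of_pos_of_lt_pi (by linarith) (by linarith)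
  have hs : sinh η = sin ζ * I := by rw [hη', sinh_mul_I]
  have hsinC : sin (ζ : ℂ) ≠ 0 := by
    rw [← ofReal_sin]; exact ofReal_ne_zero.2 hsin.ne'
  set D : ℝ → ℂ := fun θ => ∫ x, pairKernel ζ (-(3 * ζ / 2)) (ζ / 2) θ x with hD
  set M : ℝ → ℂ := fun ε => ∫ x, diagKernel ζ (-(3 * ζ / 2)) (-(ζ / 2)) ε x with hM
  set J : ℝ → ℂ := fun θ => ∫ x, ratioKernel ζ (ζ / 2) θ x with hJ
  have eI₁ : ∀ ε, I₁ ε = (sinh η)⁻¹ *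
      ∫ x₁ : ℝ, ∫ x₂ : ℝ, pairKernel ζ (-(3 * ζ / 2)) (-(ζ / 2)) (-ε) (x₁, x₂) := by
    intro ε
    rw [hI₁, ← integral_const_mul]
    congr 1 with x₁
    rw [← integral_const_mul]
    congr 1 with x₂
    have a1 : (x₁ : ℂ) - 3 * η / 2 = x₁ + (-(3 * ζ / 2) : ℝ) * I := by rw [hη']; push_cast; ring
    have a2 : (x₂ : ℂ) - η / 2 = x₂ + (-(ζ / 2) : ℝ) * I := by rw [hη']; push_cast; ring
    have a3 : (x₂ : ℂ) - x₁ - I * ε = (x₂ - x₁ : ℝ) + (-ε : ℝ) * I := by push_cast; ring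
    simp only [pairKernel]
    rw [a1, a2, a3, ofReal_rho, ofReal_rho, div_eq_mul_inv, mul_inv]
    ring
  have eI₂ : ∀ ε, I₂ ε = (sinh η)⁻¹ *
      ∫ x₁ : ℝ, ∫ x₂ : ℝ, pairKernel ζ (-(5 * ζ / 2)) (ζ / 2) (2 * ζ + ε) (x₁, x₂) := by
    intro ε
    rw [hI₂, ← integral_const_mul]
    congr 1 with x₁
    rw [← integral_const_mul]
    congr 1 with x₂
    have a1 : (x₁ : ℂ) - 5 * η / 2 = x₁ + (-(5 * ζ / 2) : ℝ) * I := by rw [hη']; push_cast; ring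
    have a2 : (x₂ : ℂ) + η / 2 = x₂ + (ζ / 2 : ℝ) * I := by rw [hη']; push_cast; ring
    have a3 : (x₂ : ℂ) - x₁ + 2 * η + I * ε = (x₂ - x₁ : ℝ) + (2 * ζ + ε : ℝ) * I := by
      rw [hη']; push_cast; ring
    simp only [pairKernel]
    rw [a1, a2, a3, ofReal_rho, ofReal_rho, div_eq_mul_inv, mul_inv]
    ring
  have eJ : ∫ x : ℝ, (rho ζ x : ℂ) * (sinh ((x : ℂ) + η / 2) / sinh ((x : ℂ) + 3 * η / 2))
      = J (3 * ζ / 2) := by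
    rw [hJ]
    congr 1 with x
    have a1 : (x : ℂ) + η / 2 = x + (ζ / 2 : ℝ) * I := by rw [hη']; push_cast; ring
    have a2 : (x : ℂ) + 3 * η / 2 = x + (3 * ζ / 2 : ℝ) * I := by rw [hη']; push_cast; ring
    rw [ratioKernel, a1, a2, ofReal_rho, div_eq_mul_inv]
    ring
  have hdiff : ∀ᶠ ε : ℝ in 𝓝[>] 0, (sinh η)⁻¹ * (-D (ζ + (-1) * ε) + 2 * Real.pi * I * M ε
      - (-D (ζ + 1 * ε) - 2 * cos ζ * sinh η * J (3 * ζ / 2 + 1 * ε))) = I₁ ε - I₂ ε := by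
    filter_upwards [self_mem_nhdsWithin,
      nhdsWithin_le_nhds (Iio_mem_nhds (show (0 : ℝ) < ζ / 2 by linarith)),
      nhdsWithin_le_nhds (Iio_mem_nhds (show (0 : ℝ) < Real.pi - 2 * ζ by linarith)),
      nhdsWithin_le_nhds (eventually_half_le_cos (Real.pi / ζ))] with ε h0 h1 h2 h3
    rw [eI₁, eI₂, first_integral_eq hζ0 hζ1 h0 h1 h3, second_integral_eq hζ0 hζ1 h0 h2, hη',
      neg_one_mul, one_mul, ← sub_eq_add_neg]
    ring
  have tD : ∀ s : ℝ, Tendsto (fun ε : ℝ => D (ζ + s * ε)) (𝓝[>] 0) (𝓝 (D ζ)) := fun s =>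
    (continuousAt_integral_pairKernel hζ0 hζ1 _ _ hsin).tendsto.comp (tendsto_line_const_add ζ s)
  have tJ : Tendsto (fun ε : ℝ => J (3 * ζ / 2 + 1 * ε)) (𝓝[>] 0) (𝓝 (J (3 * ζ / 2))) :=
    (continuousAt_integral_ratioKernel hζ0 hζ1 _ hsin3).tendsto.comp
      (tendsto_line_const_add (3 * ζ / 2) 1)
  have tM : Tendsto M (𝓝[>] 0) (𝓝 (M 0)) :=
    (continuousAt_integral_diagKernel hζ0 hζ1 _ _).tendsto.mono_left nhdsWithin_le_nhds
  refine ⟨_, (((((tD (-1)).neg.add (tM.const_mul (2 * Real.pi * I))).sub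
    ((tD 1).neg.sub (tJ.const_mul (2 * cos ζ * sinh η)))).const_mul (sinh η)⁻¹).congr' hdiff), ?_⟩
  rw [eJ, hM]
  beta_reduce
  rw [integral_diagKernel_zero hζ0 hζ1]
  have hζ' : (ζ : ℂ) ≠ 0 := ofReal_ne_zero.2 hζ0.ne'
  have hπ : (Real.pi : ℂ) ≠ 0 := ofReal_ne_zero.2 Real.pi_ne_zero
  rw [hs, cos_two_mul]
  push_cast
  field_simp
  linear_combination (8 * ζ * Complex.I) * Complex.sin_sq_add_cos_sq (ζ : ℂ)
end
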